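/- arXiv:2604.25829 — 4 statements merged into one kernel-verified Lean document; each statement's English description precedes it below -/
import Mathlib

section
/- Let G be a graph containing no induced copy of P_5, and let u be a vertex of G of degree 4 whose neighborhood {x, y, z, w} induces the 4-cycle x–y–z–w–x in G. Let G' be the graph obtained from G by deleting u and adding the edge xz. Then G' contains no induced copy of P_5. -/
open SimpleGraph

/-- `G` contains a subdivision of `H`, i.e. `H` is a topological minor of `G`:
there are branch vertices given by an injection `f` and, for each edge of `H`,
a path in `G` between the corresponding branch vertices, such that these paths
are internally disjoint from each other and from the branch vertices. -/
def ContainsSubdivision {W V : Type*} (H : SimpleGraph W) (G : SimpleGraph V) : Prop :=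
  ∃ (f : W ↪ V) (p : ∀ ⦃a b : W⦄, H.Adj a b → G.Walk (f a) (f b)),
    (∀ ⦃a b : W⦄ (h : H.Adj a b), (p h).IsPath) ∧
    (∀ ⦃a b : W⦄ (h : H.Adj a b) (w : W), f w ∈ (p h).support → w = a ∨ w = b) ∧
    (∀ ⦃a b c d : W⦄ (h₁ : H.Adj a b) (h₂ : H.Adj c d), s(a, b) ≠ s(c, d) →
      ∀ x, x ∈ (p h₁).support → x ∈ (p h₂).support →
        (x = f a ∨ x = f b) ∧ (x = f c ∨ x = f d))

/-- A graph is planar iff it contains no subdivision of `K₅` or of `K₃,₃`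
(Kuratowski's characterization). -/
def IsPlanar {V : Type*} (G : SimpleGraph V) : Prop :=
  ¬ ContainsSubdivision (completeGraph (Fin 5)) G ∧
  ¬ ContainsSubdivision (completeBipartiteGraph (Fin 3) (Fin 3)) G

/-- `G` contains an induced copy of `F`. -/
def ContainsInduced {W V : Type*} (F : SimpleGraph W) (G : SimpleGraph V) : Prop :=
  ∃ s : Set V, Nonempty (F ≃g G.induce s)

/-- Five vertices with the adjacencies of a path and no others give an induced `P₅`. -/
theorem containsInduced_pathGraph_five {V : Type*} {G : SimpleGraph V} {a b c d e : V}
    (hab : G.Adj a b) (hbc : G.Adj b c) (hcd : G.Adj c d) (hde : G.Adj d e)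
    (hac : ¬ G.Adj a c) (had : ¬ G.Adj a d) (hae : ¬ G.Adj a e)
    (hbd : ¬ G.Adj b d) (hbe : ¬ G.Adj b e) (hce : ¬ G.Adj c e) :
    ContainsInduced (pathGraph 5) G := by
  have hadj : ∀ i j : Fin 5,
      G.Adj (![a, b, c, d, e] i) (![a, b, c, d, e] j) ↔ (pathGraph 5).Adj i j := by
    intro i j
    rw [pathGraph_adj]
    fin_cases i <;> fin_cases j <;> simp [*, G.adj_comm]
  have hinj : Function.Injective ![a, b, c, d, e] := by
    have hab' := hab.ne
    have hbc' := hbc.ne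
    have hcd' := hcd.ne
    have hde' := hde.ne
    have hsymm : ∀ v v', G.Adj v v' → G.Adj v' v := fun _ _ h => h.symm
    intro i j hij
    fin_cases i <;> fin_cases j <;> simp at hij ⊢ <;> grind
  let f : pathGraph 5 ↪g G := ⟨⟨_, hinj⟩, hadj _ _⟩
  exact ⟨Set.range f, ⟨f.isoInduceRange⟩⟩

theorem stmt_12 {V : Type*} (G : SimpleGraph V)
    (hG : ¬ ContainsInduced (pathGraph 5) G)
    (u x y z w : V) (hxz : x ≠ z) (hyw : y ≠ w)
    (hN : G.neighborSet u = {x, y, z, w})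
    (hxy : G.Adj x y) (hyz : G.Adj y z) (hzw : G.Adj z w) (hwx : G.Adj w x)
    (hnxz : ¬ G.Adj x z) (hnyw : ¬ G.Adj y w) :
    ¬ ContainsInduced (pathGraph 5)
      ((G ⊔ fromEdgeSet {s(x, z)}).induce {v : V | v ≠ u}) := by
  rintro ⟨s, ⟨f⟩⟩
  have key : ∀ i j : Fin 5,
      (G.Adj (f i).1.1 (f j).1.1 ∨
        ((f i).1.1 = x ∧ (f j).1.1 = z ∨ (f i).1.1 = z ∧ (f j).1.1 = x)) ↔
      (i.val + 1 = j.val ∨ j.val + 1 = i.val) := by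
    intro i j
    rw [← pathGraph_adj, ← f.map_rel_iff]
    simp only [comap_adj, sup_adj, fromEdgeSet_adj, Function.Embedding.subtype_apply,
      Set.mem_singleton_iff, Sym2.eq_iff]
    grind
  have hu : ∀ v, G.Adj u v ↔ v = x ∨ v = y ∨ v = z ∨ v = w := fun v => by
    rw [← mem_neighborSet, hN]; simp
  have hsymm : ∀ v v', G.Adj v v' → G.Adj v' v := fun _ _ h => h.symm
  have hne : ∀ i, (f i).1.1 ≠ u := fun i => (f i).1.2
  have hinj : ∀ i j, (f i).1.1 = (f j).1.1 → i = j := fun i j h =>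
    f.injective (Subtype.ext (Subtype.ext h))
  generalize hp : (fun i => (f i).1.1) = p
  have hp' : ∀ i, (f i).1.1 = p i := fun i => congrFun hp i
  simp only [hp'] at key hne hinj
  clear hp' hp
  have h01 := key 0 1
  have h02 := key 0 2
  have h03 := key 0 3
  have h04 := key 0 4
  have h12 := key 1 2
  have h13 := key 1 3
  have h14 := key 1 4
  have h23 := key 2 3
  have h24 := key 2 4
  have h34 := key 3 4
  have hinj' : p 0 ≠ p 1 ∧ p 0 ≠ p 2 ∧ p 0 ≠ p 3 ∧ p 0 ≠ p 4 ∧ p 1 ≠ p 2 ∧ p 1 ≠ p 3 ∧ p 1 ≠ p 4 ∧ p 2 ≠ p 3 ∧ p 2 ≠ p 4 ∧ p 3 ≠ p 4 := by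
    refine ⟨?_, ?_, ?_, ?_, ?_, ?_, ?_, ?_, ?_, ?_⟩ <;>
      exact fun h => absurd (hinj _ _ h) (by decide)
  have hne0 := hne 0
  have hne1 := hne 1
  have hne2 := hne 2
  have hne3 := hne 3
  have hne4 := hne 4
  clear key hne hinj
  simp at h01 h02 h03 h04 h12 h13 h14 h23 h24 h34
  generalize p 0 = a at *
  generalize p 1 = b at *
  generalize p 2 = c at *
  generalize p 3 = d at *
  generalize p 4 = e at *
  by_cases hab : G.Adj a b
  · by_cases hbc : G.Adj b c
    · by_cases hcd : G.Adj c d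
      · by_cases hde : G.Adj d e
        · exact hG (containsInduced_pathGraph_five hab hbc hcd hde
            h02.1 h03.1 h04.1 h13.1 h14.1 h24.1)
        · refine hG (containsInduced_pathGraph_five (a := b) (b := c) (c := d) (d := u) (e := e)
            ?_ ?_ ?_ ?_ ?_ ?_ ?_ ?_ ?_ ?_) <;> grind
      · refine hG (containsInduced_pathGraph_five (a := a) (b := b) (c := c) (d := u) (e := d)
          ?_ ?_ ?_ ?_ ?_ ?_ ?_ ?_ ?_ ?_) <;> grind
    · refine hG (containsInduced_pathGraph_five (a := a) (b := b) (c := u) (d := c) (e := d)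
        ?_ ?_ ?_ ?_ ?_ ?_ ?_ ?_ ?_ ?_) <;> grind
  · refine hG (containsInduced_pathGraph_five (a := a) (b := u) (c := b) (d := c) (e := d)
      ?_ ?_ ?_ ?_ ?_ ?_ ?_ ?_ ?_ ?_) <;> grind
end

section
/- Let G be a graph containing no induced copy of P_5, and let u be a vertex of G of degree 5 whose neighborhood {x, y, z, w, v} induces the 5-cycle x–y–z–w–v–x in G. Let G' be the graph obtained from G by deleting u and adding the two edges xz and xw. Then G' contains no induced copy of P_5. -/
open SimpleGraph

/-- The vertices `a, b, c, d, e`, in this order, induce a path in `G`; that they are distinct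
follows from the adjacencies. -/
def IsInducedPath5 {V : Type*} (G : SimpleGraph V) (a b c d e : V) : Prop :=
  (G.Adj a b ∧ G.Adj b c ∧ G.Adj c d ∧ G.Adj d e) ∧
  ¬ G.Adj a c ∧ ¬ G.Adj a d ∧ ¬ G.Adj a e ∧ ¬ G.Adj b d ∧ ¬ G.Adj b e ∧ ¬ G.Adj c e

lemma IsInducedPath5.reverse {V : Type*} {G : SimpleGraph V} {a b c d e : V}
    (h : IsInducedPath5 G a b c d e) : IsInducedPath5 G e d c b a := by
  simp only [IsInducedPath5] at h ⊢
  grind [G.adj_comm]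

lemma IsInducedPath5.containsInduced {V : Type*} {G : SimpleGraph V} {a b c d e : V}
    (h : IsInducedPath5 G a b c d e) : ContainsInduced (pathGraph 5) G := by
  obtain ⟨⟨hab, hbc, hcd, hde⟩, hac, had, hae, hbd, hbe, hce⟩ := h
  have hadj : ∀ i j : Fin 5, G.Adj (![a, b, c, d, e] i) (![a, b, c, d, e] j) ↔
      (pathGraph 5).Adj i j := by
    intro i j
    rw [pathGraph_adj]
    fin_cases i <;> fin_cases j <;> simp [G.adj_comm, *]
  have hinj : Function.Injective ![a, b, c, d, e] := by
    intro i j hij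
    have key : ∀ k, (pathGraph 5).Adj i k ↔ (pathGraph 5).Adj j k := fun k => by
      rw [← hadj, ← hadj, hij]
    simp only [pathGraph_adj] at key
    clear hij
    revert i j
    decide
  let f : pathGraph 5 ↪g G := ⟨⟨_, hinj⟩, hadj _ _⟩
  exact ⟨Set.range f, ⟨f.isoInduceRange⟩⟩

lemma exists_isInducedPath5_of_induce {V : Type*} {H : SimpleGraph V} {t : Set V}
    (h : ContainsInduced (pathGraph 5) (H.induce t)) :
    ∃ a b c d e, IsInducedPath5 H a b c d e := by
  obtain ⟨s, ⟨f⟩⟩ := h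
  have key : ∀ i j : Fin 5, H.Adj (f i).1.1 (f j).1.1 ↔ (pathGraph 5).Adj i j :=
    fun i j => f.map_rel_iff
  refine ⟨f 0, f 1, f 2, f 3, f 4, ?_⟩
  simp only [IsInducedPath5, key, pathGraph_adj]
  decide

/-- Up to reversal, an induced path of the new graph through the new edge `xz` occurs in one of
these four positions; rerouting it through `u` gives an induced path of `G`. -/
lemma not_isInducedPath5_of_new_edge {V : Type*} {G H : SimpleGraph V}
    (hG : ∀ a b c d e, ¬ IsInducedPath5 G a b c d e) {u x y z w v : V}
    (hxz : x ≠ z) (hxw : x ≠ w)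
    (hN : ∀ a, G.Adj u a ↔ a = x ∨ a = y ∨ a = z ∨ a = w ∨ a = v)
    (hH : ∀ a b, H.Adj a b ↔ G.Adj a b ∨
      (a = x ∧ (b = z ∨ b = w)) ∨ (b = x ∧ (a = z ∨ a = w)))
    (hxy : G.Adj x y) (hyz : G.Adj y z) (hzw : G.Adj z w) (hvx : G.Adj v x)
    (hnxz : ¬ G.Adj x z) (hnzv : ¬ G.Adj z v) {a b c : V} :
    ¬ IsInducedPath5 H x z a b c ∧ ¬ IsInducedPath5 H z x a b c ∧
    ¬ IsInducedPath5 H a x z b c ∧ ¬ IsInducedPath5 H a z x b c := by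
  have hs := G.adj_comm
  have hir : ∀ p, ¬ G.Adj p p := fun _ => G.irrefl
  simp only [IsInducedPath5, hH] at hG ⊢
  refine ⟨?_, ?_, ?_, ?_⟩ <;> intro h
  · have := hG u z a b c
    clear hG hH
    grind
  · by_cases hv : a = v
    · have := hG z u a b c
      clear hG hH
      subst hv
      grind
    · have := hG u x a b c
      clear hG hH
      grind
  · by_cases hv : a = v
    · have := hG a u z b c
      clear hG hH
      subst hv
      grind
    · have := hG a x u z b
      clear hG hH
      grind
  · by_cases hv : b = v
    · have := hG a z u b c
      clear hG hH
      subst hv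
      grind
    · have := hG a z u x b
      clear hG hH
      grind

theorem stmt_13 {V : Type*} (G : SimpleGraph V)
    (hG : ¬ ContainsInduced (pathGraph 5) G)
    (u x y z w v : V) (hxz : x ≠ z) (hxw : x ≠ w) (hyw : y ≠ w) (hyv : y ≠ v)
    (hzv : z ≠ v)
    (hN : G.neighborSet u = {x, y, z, w, v})
    (hxy : G.Adj x y) (hyz : G.Adj y z) (hzw : G.Adj z w) (hwv : G.Adj w v)
    (hvx : G.Adj v x)
    (hnxz : ¬ G.Adj x z) (hnxw : ¬ G.Adj x w) (hnyw : ¬ G.Adj y w)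
    (hnyv : ¬ G.Adj y v) (hnzv : ¬ G.Adj z v) :
    ¬ ContainsInduced (pathGraph 5)
      ((G ⊔ fromEdgeSet {s(x, z), s(x, w)}).induce {a : V | a ≠ u}) := by
  intro h
  obtain ⟨a, b, c, d, e, hP⟩ := exists_isInducedPath5_of_induce h
  have hG' : ∀ a b c d e, ¬ IsInducedPath5 G a b c d e := fun _ _ _ _ _ h => hG h.containsInduced
  have hN' : ∀ a, G.Adj u a ↔ a = x ∨ a = y ∨ a = z ∨ a = w ∨ a = v := fun a => by
    rw [← mem_neighborSet, hN]
    simp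
  generalize hH₀ : G ⊔ fromEdgeSet {s(x, z), s(x, w)} = H at hP
  have hH : ∀ a b, H.Adj a b ↔ G.Adj a b ∨
      (a = x ∧ (b = z ∨ b = w)) ∨ (b = x ∧ (a = z ∨ a = w)) := fun a b => by
    simp only [← hH₀, sup_adj, fromEdgeSet_adj, Set.mem_insert_iff, Set.mem_singleton_iff,
      Sym2.eq_iff]
    grind
  have hz {a b c : V} := not_isInducedPath5_of_new_edge (a := a) (b := b) (c := c) hG' hxz hxw
    hN' hH hxy hyz hzw hvx hnxz hnzv
  have hw {a b c : V} := not_isInducedPath5_of_new_edge (a := a) (b := b) (c := c)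
    (y := v) (z := w) (w := z) (v := y) hG' hxw hxz
    (fun a => by rw [hN']; tauto) (fun a b => by rw [hH]; tauto)
    hvx.symm hwv.symm hzw.symm hxy.symm hnxw (fun h => hnyw h.symm)
  have hR := hP.reverse
  have old {p q : V} (hpq : H.Adj p q) (h : ¬ G.Adj p q) :
      (p = x ∧ q = z) ∨ (p = z ∧ q = x) ∨ (p = x ∧ q = w) ∨ (p = w ∧ q = x) := by
    have := (hH p q).1 hpq
    tauto
  have hle {p q : V} (h : ¬ H.Adj p q) : ¬ G.Adj p q := fun h' => h ((hH p q).2 (.inl h'))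
  by_cases hab : G.Adj a b
  · by_cases hbc : G.Adj b c
    · by_cases hcd : G.Adj c d
      · by_cases hde : G.Adj d e
        · obtain ⟨-, h1, h2, h3, h4, h5, h6⟩ := hP
          exact hG' a b c d e
            ⟨⟨hab, hbc, hcd, hde⟩, hle h1, hle h2, hle h3, hle h4, hle h5, hle h6⟩
        · rcases old hP.1.2.2.2 hde with ⟨rfl, rfl⟩ | ⟨rfl, rfl⟩ | ⟨rfl, rfl⟩ | ⟨rfl, rfl⟩
          exacts [hz.2.1 hR, hz.1 hR, hw.2.1 hR,
            hw.1 hR]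
      · rcases old hP.1.2.2.1 hcd with ⟨rfl, rfl⟩ | ⟨rfl, rfl⟩ | ⟨rfl, rfl⟩ | ⟨rfl, rfl⟩
        exacts [hz.2.2.2 hR, hz.2.2.1 hR, hw.2.2.2 hR,
          hw.2.2.1 hR]
    · rcases old hP.1.2.1 hbc with ⟨rfl, rfl⟩ | ⟨rfl, rfl⟩ | ⟨rfl, rfl⟩ | ⟨rfl, rfl⟩
      exacts [hz.2.2.1 hP, hz.2.2.2 hP, hw.2.2.1 hP,
        hw.2.2.2 hP]
  · rcases old hP.1.1 hab with ⟨rfl, rfl⟩ | ⟨rfl, rfl⟩ | ⟨rfl, rfl⟩ | ⟨rfl, rfl⟩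
    exacts [hz.1 hP, hz.2.1 hP, hw.1 hP, hw.2.1 hP]
end

section
/- Every triangulation on at least 9 vertices contains an induced copy of P_5; that is, every planar graph on n ≥ 9 vertices with exactly 3n − 6 edges contains an induced copy of P_5. -/
open SimpleGraph

/-- `a` and `b` are joined in `G` by a walk all of whose other vertices lie in `I`. -/
def Linked {V : Type*} (G : SimpleGraph V) (I : Set V) (a b : V) : Prop :=
  ∃ w : G.Walk a b, ∀ x ∈ w.support, x = a ∨ x = b ∨ x ∈ I

namespace Linked

variable {V : Type*} {G : SimpleGraph V} {I J : Set V} {a b c : V}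

theorem of_adj (h : G.Adj a b) : Linked G I a b :=
  ⟨h.toWalk, by simp⟩

theorem symm (h : Linked G I a b) : Linked G I b a := by
  obtain ⟨w, hw⟩ := h
  refine ⟨w.reverse, fun x hx => ?_⟩
  have := hw x (by simpa using hx)
  tauto

theorem mono (h : Linked G I a b) (hIJ : I ⊆ J) : Linked G J a b := by
  obtain ⟨w, hw⟩ := h
  refine ⟨w, fun x hx => ?_⟩
  have := hw x hx
  have := @hIJ x
  tauto

theorem cons (hab : G.Adj a b) (h : Linked G I b c) : Linked G (insert b I) a c := by
  obtain ⟨w, hw⟩ := h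
  refine ⟨.cons hab w, fun x hx => ?_⟩
  rw [SimpleGraph.Walk.support_cons, List.mem_cons] at hx
  rcases hx with hx | hx
  · exact Or.inl hx
  · have := hw x hx
    simp only [Set.mem_insert_iff]
    tauto

end Linked

/-- A subdivision of `H` in `G`, described by its branch vertices `f` and by disjoint sets `I`
containing the interiors of the paths replacing the edges of `H`. -/
structure SubdivisionModel {W V : Type*} (H : SimpleGraph W) (G : SimpleGraph V)
    (f : W → V) (I : Sym2 W → Set V) : Prop where
  injective : Function.Injective f
  notMem : ∀ e w, f w ∉ I e
  disjoint : ∀ ⦃a b c d : W⦄, H.Adj a b → H.Adj c d → s(a, b) ≠ s(c, d) →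
    Disjoint (I s(a, b)) (I s(c, d))
  linked : ∀ ⦃a b : W⦄, H.Adj a b → Linked G (I s(a, b)) (f a) (f b)

theorem SubdivisionModel.containsSubdivision {W V : Type*} {H : SimpleGraph W}
    {G : SimpleGraph V} {f : W → V} {I : Sym2 W → Set V} (M : SubdivisionModel H G f I) :
    ContainsSubdivision H G := by
  classical
  choose p hp using M.linked
  have hp' : ∀ ⦃a b : W⦄ (h : H.Adj a b), ∀ x ∈ (p h).bypass.support,
      x = f a ∨ x = f b ∨ x ∈ I s(a, b) := fun a b h x hx =>
    hp h x ((p h).support_bypass_subset_support hx)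
  refine ⟨⟨f, M.injective⟩, fun a b h => (p h).bypass, fun a b h => (p h).bypass_isPath, ?_, ?_⟩
  · intro a b h w hw
    rcases hp' h _ hw with e | e | e
    · exact Or.inl (M.injective e)
    · exact Or.inr (M.injective e)
    · exact absurd e (M.notMem _ _)
  · intro a b c d h₁ h₂ hne x hx₁ hx₂
    have hd := M.disjoint h₁ h₂ hne
    have := hp' h₁ x hx₁
    have := hp' h₂ x hx₂
    have hn := M.notMem
    have : x ∈ I s(a, b) → x ∉ I s(c, d) := fun h h' => Set.disjoint_left.mp hd h h'
    simp only [Function.Embedding.coeFn_mk]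
    grind

/-- A structural form of the failure of `IsPlanar`. -/
def Nonplanar {V : Type*} (G : SimpleGraph V) : Prop :=
  (∃ f I, SubdivisionModel (completeGraph (Fin 5)) G f I) ∨
    ∃ f I, SubdivisionModel (completeBipartiteGraph (Fin 3) (Fin 3)) G f I

theorem IsPlanar.not_nonplanar {V : Type*} {G : SimpleGraph V} (h : IsPlanar G) :
    ¬ Nonplanar G := by
  rintro (⟨f, I, M⟩ | ⟨f, I, M⟩)
  · exact h.1 M.containsSubdivision
  · exact h.2 M.containsSubdivision

theorem SubdivisionModel.mono {W V : Type*} {H : SimpleGraph W} {G G' : SimpleGraph V}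
    {f : W → V} {I : Sym2 W → Set V} (M : SubdivisionModel H G f I) (h : G ≤ G') :
    SubdivisionModel H G' f I where
  injective := M.injective
  notMem := M.notMem
  disjoint := M.disjoint
  linked a b hab := by
    obtain ⟨w, hw⟩ := M.linked hab
    exact ⟨w.mapLe h, by simpa using hw⟩

theorem Nonplanar.mono {V : Type*} {G G' : SimpleGraph V} (hG : Nonplanar G) (h : G ≤ G') :
    Nonplanar G' := by
  rcases hG with ⟨f, I, M⟩ | ⟨f, I, M⟩
  · exact Or.inl ⟨f, I, M.mono h⟩
  · exact Or.inr ⟨f, I, M.mono h⟩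

theorem nonplanar_of_bipartite {V : Type*} {G : SimpleGraph V} (p q : Fin 3 → V)
    (J : Fin 3 → Fin 3 → Set V) (hp : Function.Injective p) (hq : Function.Injective q)
    (hpq : ∀ i j, p i ≠ q j) (hpJ : ∀ i j k, p i ∉ J j k) (hqJ : ∀ i j k, q i ∉ J j k)
    (hJ : ∀ i j k l, (i, j) ≠ (k, l) → Disjoint (J i j) (J k l))
    (hl : ∀ i j, Linked G (J i j) (p i) (q j)) : Nonplanar G := by
  refine Or.inr ⟨Sum.elim p q, fun e => {x | ∃ i j, e = s(.inl i, .inr j) ∧ x ∈ J i j}, ?_, ?_, ?_, ?_⟩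
  · exact hp.sumElim hq hpq
  · rintro e (w | w) ⟨i, j, -, h⟩
    · exact hpJ _ _ _ h
    · exact hqJ _ _ _ h
  · intro a b c d _ _ hne
    rw [Set.disjoint_left]
    rintro x ⟨i, j, e, h⟩ ⟨k, l, e', h'⟩
    refine Set.disjoint_left.mp (hJ i j k l fun hh => hne ?_) h h'
    simp only [Prod.mk.injEq] at hh
    rw [e, e', hh.1, hh.2]
  · have key : ∀ i j, Linked G {x | ∃ i' j', (s(.inl i, .inr j) : Sym2 (Fin 3 ⊕ Fin 3)) =
        s(.inl i', .inr j') ∧ x ∈ J i' j'} (p i) (q j) := fun i j =>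
      (hl i j).mono fun x hx => ⟨i, j, rfl, hx⟩
    rintro (i | i) (j | j) h
    · simp at h
    · exact key i j
    · rw [Sym2.eq_swap]
      exact (key j i).symm
    · simp at h

/-- The contraction of the edge `uv` onto `u`, on the same vertex type: `v` becomes isolated. -/
def contract {V : Type*} (G : SimpleGraph V) (u v : V) : SimpleGraph V where
  Adj a b := a ≠ b ∧ a ≠ v ∧ b ≠ v ∧ (G.Adj a b ∨ a = u ∧ G.Adj v b ∨ b = u ∧ G.Adj v a)
  symm := ⟨fun a b h => by
    obtain ⟨h₁, h₂, h₃, h₄⟩ := h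
    refine ⟨h₁.symm, h₃, h₂, ?_⟩
    rw [G.adj_comm b a]
    tauto⟩
  loopless := ⟨fun a h => h.1 rfl⟩

section Contract

variable {V : Type*} {G : SimpleGraph V} {u v : V}

theorem contract_adj {a b : V} : (contract G u v).Adj a b ↔
    a ≠ b ∧ a ≠ v ∧ b ≠ v ∧ (G.Adj a b ∨ a = u ∧ G.Adj v b ∨ b = u ∧ G.Adj v a) :=
  Iff.rfl

theorem exists_walk_of_contract (huv : G.Adj u v) {a b : V} (w : (contract G u v).Walk a b) :
    ∃ q : G.Walk a b, ∀ x ∈ q.support, x ∈ w.support ∨ x = v ∧ u ∈ w.support := by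
  induction w with
  | nil => exact ⟨.nil, by simp⟩
  | @cons a c b h w ih =>
    obtain ⟨q, hq⟩ := ih
    obtain ⟨-, -, -, h' | ⟨rfl, h'⟩ | ⟨rfl, h'⟩⟩ := contract_adj.mp h
    · refine ⟨.cons h' q, fun x hx => ?_⟩
      simp only [SimpleGraph.Walk.support_cons, List.mem_cons] at hx ⊢
      have := hq x
      tauto
    · refine ⟨.cons huv (.cons h' q), fun x hx => ?_⟩
      simp only [SimpleGraph.Walk.support_cons, List.mem_cons] at hx ⊢
      have := hq x
      tauto
    · refine ⟨.cons h'.symm (.cons huv.symm q), fun x hx => ?_⟩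
      simp only [SimpleGraph.Walk.support_cons, List.mem_cons] at hx ⊢
      have := hq x
      have := w.start_mem_support
      tauto

theorem notMem_support_of_contract {a b : V} (w : (contract G u v).Walk a b) (hab : a ≠ b) :
    v ∉ w.support := by
  have aux : ∀ {a b : V} (w : (contract G u v).Walk a b), b ≠ v → v ∉ w.support := by
    intro a b w hb
    induction w with
    | nil => simpa using hb.symm
    | cons h w ih =>
      rw [SimpleGraph.Walk.support_cons, List.mem_cons]
      rintro (e | e)
      · exact h.2.1 e.symm
      · exact ih hb e
  by_cases hb : b = v
  · cases w.reverse with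
    | nil => exact absurd rfl hab
    | cons h _ => exact absurd hb h.2.1
  · exact aux w hb

theorem Linked.of_contract (huv : G.Adj u v) {I : Set V} {a b : V}
    (h : Linked (contract G u v) I a b) (hu : u ∈ I → v ∈ I) (ha : a ≠ u)
    (hb : b ≠ u) : Linked G I a b := by
  obtain ⟨w, hw⟩ := h
  obtain ⟨q, hq⟩ := exists_walk_of_contract huv w
  refine ⟨q, fun x hx => ?_⟩
  rcases hq x hx with h | ⟨rfl, h⟩
  · exact hw x h
  · have := hw u h
    tauto

theorem Linked.of_contract_left (huv : G.Adj u v) {I : Set V} {b : V}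
    (h : Linked (contract G u v) I u b) (hub : u ≠ b) :
    Linked G (I \ {v}) u b ∨ Linked G (I \ {v}) v b := by
  classical
  obtain ⟨w, hw⟩ := h
  have hw' : ∀ x ∈ w.bypass.support, x = u ∨ x = b ∨ x ∈ I := fun x hx =>
    hw x (w.support_bypass_subset_support hx)
  have hv := notMem_support_of_contract w.bypass hub
  have hP := w.bypass_isPath
  generalize w.bypass = p at hw' hP hv
  cases p with
  | nil => exact absurd rfl hub
  | @cons _ c _ h p =>
    rw [SimpleGraph.Walk.cons_isPath_iff] at hP
    obtain ⟨q, hq⟩ := exists_walk_of_contract huv p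
    have hs : ∀ x ∈ q.support, x = b ∨ x ∈ I \ {v} := by
      intro x hx
      have h1 : x ∈ p.support := by have := hq x hx; tauto
      have h2 : x ≠ u := fun e => hP.2 (e ▸ h1)
      have h3 : x ≠ v := by
        rintro rfl
        exact hv (by simp [h1])
      have := hw' x (by simp [h1])
      simp only [Set.mem_sdiff, Set.mem_singleton_iff]
      tauto
    have hcu : c ≠ u := h.1.symm
    obtain ⟨-, -, -, h | ⟨-, h⟩ | ⟨e, h⟩⟩ := contract_adj.mp h
    · refine Or.inl ⟨.cons h q, fun x hx => ?_⟩
      simp only [SimpleGraph.Walk.support_cons, List.mem_cons] at hx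
      have := hs x
      tauto
    · refine Or.inr ⟨.cons h q, fun x hx => ?_⟩
      simp only [SimpleGraph.Walk.support_cons, List.mem_cons] at hx
      have := hs x
      tauto
    · exact absurd e hcu

/-- Recentre a branch vertex at `c`, where one of the links at it may start from the
neighbour `d` of `c` instead. -/
theorem SubdivisionModel.recenter {W : Type*} {H : SimpleGraph W} {f : W → V}
    {I : Sym2 W → Set V} {a₀ b₀ : W} {c d : V} (hcd : G.Adj c d)
    (hf : Function.Injective f) (hfc : ∀ w ≠ a₀, f w ≠ c ∧ f w ≠ d)
    (hfI : ∀ e, ∀ w ≠ a₀, f w ∉ I e) (hIc : ∀ e, c ∉ I e ∧ d ∉ I e)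
    (hdis : ∀ ⦃a b c d : W⦄, H.Adj a b → H.Adj c d → s(a, b) ≠ s(c, d) →
      Disjoint (I s(a, b)) (I s(c, d)))
    (hl : ∀ ⦃a b : W⦄, H.Adj a b → a ≠ a₀ → b ≠ a₀ → Linked G (I s(a, b)) (f a) (f b))
    (hstar : ∀ b, H.Adj a₀ b → b ≠ b₀ → Linked G (I s(a₀, b)) c (f b))
    (hb₀ : H.Adj a₀ b₀ → Linked G (I s(a₀, b₀)) c (f b₀) ∨ Linked G (I s(a₀, b₀)) d (f b₀)) :
    ∃ f I, SubdivisionModel H G f I := by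
  classical
  have key : ∀ b, H.Adj a₀ b →
      Linked G (I s(a₀, b) ∪ {x | x = d ∧ s(a₀, b) = s(a₀, b₀)}) c (f b) := by
    intro b hb
    by_cases e : b = b₀
    · subst e
      rcases hb₀ hb with h | h
      · exact h.mono Set.subset_union_left
      · refine (h.cons hcd).mono ?_
        rintro x (rfl | hx)
        · exact Or.inr ⟨rfl, rfl⟩
        · exact Or.inl hx
    · exact (hstar b hb e).mono Set.subset_union_left
  refine ⟨Function.update f a₀ c, fun e => I e ∪ {x | x = d ∧ e = s(a₀, b₀)}, ?_, ?_, ?_, ?_⟩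
  · intro x y hxy
    by_cases hx : x = a₀ <;> by_cases hy : y = a₀
    · rw [hx, hy]
    · subst hx
      simp only [Function.update_self, Function.update_of_ne hy] at hxy
      exact absurd hxy.symm (hfc y hy).1
    · subst hy
      simp only [Function.update_self, Function.update_of_ne hx] at hxy
      exact absurd hxy (hfc x hx).1
    · simp only [Function.update_of_ne hx, Function.update_of_ne hy] at hxy
      exact hf hxy
  · intro e w
    by_cases hw : w = a₀
    · subst hw
      rw [Function.update_self]
      rintro (h | ⟨h, -⟩)
      · exact (hIc e).1 h
      · exact hcd.ne h
    · rw [Function.update_of_ne hw]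
      rintro (h | ⟨h, -⟩)
      · exact hfI e w hw h
      · exact (hfc w hw).2 h
  · intro a b a' b' h h' hne
    have := hdis h h' hne
    rw [Set.disjoint_left] at this ⊢
    rintro x (hx | ⟨rfl, hx⟩) (hx' | ⟨e, hx'⟩)
    · exact this hx hx'
    · exact (hIc _).2 (e ▸ hx)
    · exact (hIc _).2 hx'
    · exact hne (hx.trans hx'.symm)
  · intro a b hab
    by_cases ha : a = a₀
    · subst ha
      rw [Function.update_self, Function.update_of_ne hab.ne.symm]
      exact key b hab
    · by_cases hb : b = a₀
      · subst hb
        rw [Function.update_self, Function.update_of_ne ha, Sym2.eq_swap]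
        exact (key a hab.symm).symm
      · rw [Function.update_of_ne ha, Function.update_of_ne hb]
        exact (hl hab ha hb).mono Set.subset_union_left

/-- A subdivision model in a contraction either lifts, or has at least two links at the contracted
branch vertex on either side. -/
theorem SubdivisionModel.of_contract {W : Type*} {H : SimpleGraph W} {f : W → V}
    {I : Sym2 W → Set V} (huv : G.Adj u v) (hH : ∀ w, ∃ w', H.Adj w w')
    (M : SubdivisionModel H (contract G u v) f I) :
    (∃ f I, SubdivisionModel H G f I) ∨
    ∃ (a₀ : W) (I : Sym2 W → Set V), f a₀ = u ∧ (∀ w, f w ≠ v) ∧ (∀ e w, f w ∉ I e) ∧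
      (∀ e, v ∉ I e) ∧
      (∀ ⦃a b c d : W⦄, H.Adj a b → H.Adj c d → s(a, b) ≠ s(c, d) →
        Disjoint (I s(a, b)) (I s(c, d))) ∧
      (∀ ⦃a b : W⦄, H.Adj a b → a ≠ a₀ → b ≠ a₀ → Linked G (I s(a, b)) (f a) (f b)) ∧
      ∃ x y z w, H.Adj a₀ x ∧ H.Adj a₀ y ∧ H.Adj a₀ z ∧ H.Adj a₀ w ∧
        [x, y, z, w].Nodup ∧
        Linked G (I s(a₀, x)) v (f x) ∧ Linked G (I s(a₀, y)) v (f y) ∧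
        Linked G (I s(a₀, z)) u (f z) ∧ Linked G (I s(a₀, w)) u (f w) := by
  classical
  have hfv : ∀ w, f w ≠ v := by
    intro a e
    obtain ⟨b, hab⟩ := hH a
    obtain ⟨p, -⟩ := M.linked hab
    have hv : ∀ y ∈ p.support, y ≠ v := fun y hy h =>
      notMem_support_of_contract p (M.injective.ne hab.ne) (h ▸ hy)
    exact hv _ p.start_mem_support e
  by_cases hu : ∃ a₀, f a₀ = u
  · obtain ⟨a₀, ha₀⟩ := hu
    have hfu : ∀ w ≠ a₀, f w ≠ u := fun w hw e => hw (M.injective (e.trans ha₀.symm))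
    have hIu : ∀ e, u ∉ I e := fun e => ha₀ ▸ M.notMem e a₀
    have hfI : ∀ e w, f w ∉ I e \ {v} := fun e w h => M.notMem e w h.1
    have hIv : ∀ e, v ∉ I e \ {v} := fun e h => h.2 rfl
    have hdis : ∀ ⦃a b c d : W⦄, H.Adj a b → H.Adj c d → s(a, b) ≠ s(c, d) →
        Disjoint (I s(a, b) \ {v}) (I s(c, d) \ {v}) := fun a b c d h h' hne =>
      (M.disjoint h h' hne).mono Set.sdiff_subset Set.sdiff_subset
    have hl : ∀ ⦃a b : W⦄, H.Adj a b → a ≠ a₀ → b ≠ a₀ →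
        Linked G (I s(a, b) \ {v}) (f a) (f b) := by
      intro a b hab ha hb
      obtain ⟨w, hw⟩ := M.linked hab
      refine Linked.of_contract huv ⟨w, fun x hx => ?_⟩
        (fun h => absurd h.1 (hIu _)) (hfu a ha) (hfu b hb)
      rcases hw x hx with h | h | h
      · exact Or.inl h
      · exact Or.inr (Or.inl h)
      · refine Or.inr (Or.inr ⟨h, ?_⟩)
        rintro rfl
        exact notMem_support_of_contract w (M.injective.ne hab.ne) hx
    have hstar : ∀ b, H.Adj a₀ b → Linked G (I s(a₀, b) \ {v}) u (f b) ∨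
        Linked G (I s(a₀, b) \ {v}) v (f b) := by
      intro b hb
      refine Linked.of_contract_left huv ?_ (hfu b hb.ne.symm).symm
      have := M.linked hb
      rwa [ha₀] at this
    by_cases h1 : ∃ b₀, ∀ b, H.Adj a₀ b → b ≠ b₀ → Linked G (I s(a₀, b) \ {v}) u (f b)
    · obtain ⟨b₀, h1⟩ := h1
      exact Or.inl (recenter (I := fun e => I e \ {v}) huv M.injective
        (fun w hw => ⟨hfu w hw, hfv w⟩)
        (fun e w _ => hfI e w) (fun e => ⟨fun h => hIu e h.1, hIv e⟩) hdis hl h1 (hstar b₀))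
    by_cases h2 : ∃ b₀, ∀ b, H.Adj a₀ b → b ≠ b₀ → Linked G (I s(a₀, b) \ {v}) v (f b)
    · obtain ⟨b₀, h2⟩ := h2
      exact Or.inl (recenter (I := fun e => I e \ {v}) huv.symm M.injective
        (fun w hw => ⟨hfv w, hfu w hw⟩)
        (fun e w _ => hfI e w) (fun e => ⟨hIv e, fun h => hIu e h.1⟩) hdis hl h2
        fun h => (hstar b₀ h).symm)
    push Not at h1 h2
    obtain ⟨x, hx, -, hx'⟩ := h1 a₀
    obtain ⟨y, hy, hyx, hy'⟩ := h1 x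
    obtain ⟨z, hz, -, hz'⟩ := h2 a₀
    obtain ⟨w, hw, hwz, hw'⟩ := h2 z
    refine Or.inr ⟨a₀, fun e => I e \ {v}, ha₀, hfv, hfI, hIv, hdis, hl, x, y, z, w, hx, hy, hz, hw,
      ?_, (hstar x hx).resolve_left hx', (hstar y hy).resolve_left hy',
      (hstar z hz).resolve_right hz', (hstar w hw).resolve_right hw'⟩
    have hne : ∀ {i j}, ¬ Linked G (I s(a₀, i) \ {v}) u (f i) →
        ¬ Linked G (I s(a₀, j) \ {v}) v (f j) → H.Adj a₀ j → i ≠ j := by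
      rintro i _ hi hj h rfl
      exact (hstar i h).elim hi hj
    simp [hyx.symm, hwz.symm, hne hx' hz' hz, hne hx' hw' hw, hne hy' hz' hz, hne hy' hw' hw]
  · push Not at hu
    refine Or.inl ⟨f, fun e => (I e \ {v}) ∪ {x | x = v ∧ u ∈ I e}, M.injective, ?_, ?_, ?_⟩
    · rintro e w (h | h)
      · exact M.notMem e w h.1
      · exact hfv w h.1
    · intro a b c d h h' hne
      have := M.disjoint h h' hne
      rw [Set.disjoint_left] at this ⊢
      rintro x (⟨hx, hx₁⟩ | ⟨rfl, hx⟩) (⟨hx', hx'₁⟩ | ⟨e, hx'⟩)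
      · exact this hx hx'
      · exact hx₁ e
      · exact hx'₁ rfl
      · exact this hx hx'
    · intro a b hab
      have hne := M.injective.ne hab.ne
      obtain ⟨w, hw⟩ := M.linked hab
      refine Linked.of_contract huv ⟨w, fun x hx => ?_⟩ ?_ (hu a) (hu b)
      · have hxv : x ≠ v := by
          rintro rfl
          exact notMem_support_of_contract w hne hx
        have := hw x hx
        simp only [Set.mem_union, Set.mem_sdiff, Set.mem_singleton_iff, Set.mem_ofPred_eq]
        tauto
      · rintro (h | h)
        · exact Or.inr ⟨rfl, h.1⟩
        · exact absurd h.1 huv.ne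

theorem Nonplanar.of_contract (huv : G.Adj u v) (h : Nonplanar (contract G u v)) :
    Nonplanar G := by
  rcases h with ⟨f, I, M⟩ | ⟨f, I, M⟩
  · rcases M.of_contract huv (fun w => ⟨w + 1, by simp⟩) with
      h | ⟨a, I, ha, hfv, hfI, hIv, hdis, hl, x, y, z, w, hx, hy, hz, hw, hnd, hx', hy', hz', hw'⟩
    · exact Or.inl h
    simp only [completeGraph_eq_top, top_adj, List.nodup_cons, List.mem_cons, List.not_mem_nil,
      or_false, not_or, not_false_eq_true, List.nodup_nil, and_true] at hx hy hz hw hnd hl hdis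
    have hfu : ∀ i, i ≠ a → f i ≠ u := fun i hi e => hi (M.injective (e.trans ha.symm))
    have hIu : ∀ e, u ∉ I e := fun e => ha ▸ hfI e a
    refine nonplanar_of_bipartite ![v, f z, f w] ![u, f x, f y]
      ![![∅, I s(a, x), I s(a, y)], ![I s(a, z), I s(z, x), I s(z, y)],
        ![I s(a, w), I s(w, x), I s(w, y)]] ?_ ?_ ?_ ?_ ?_ ?_ ?_
    · intro i j
      have := M.injective.eq_iff (a := z) (b := w)
      have := hfv z
      have := hfv w
      fin_cases i <;> fin_cases j <;> simp <;> grind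
    · intro i j
      have := M.injective.eq_iff (a := x) (b := y)
      have := hfu x hx.symm
      have := hfu y hy.symm
      fin_cases i <;> fin_cases j <;> simp <;> grind
    · intro i j
      have := @M.injective
      have := hfu z hz.symm
      have := hfu w hw.symm
      have := hfv x
      have := hfv y
      have := huv.ne
      fin_cases i <;> fin_cases j <;> simp [M.injective.eq_iff] <;> grind
    · intro i j k
      fin_cases i <;> fin_cases j <;> fin_cases k <;> simp [hIv, hfI]
    · intro i j k
      fin_cases i <;> fin_cases j <;> fin_cases k <;> simp [hIu, hfI]
    · intro i j k l hne
      obtain ⟨⟨h1, h2, h3⟩, ⟨h4, h5⟩, h6⟩ := hnd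
      fin_cases i <;> fin_cases j <;> fin_cases k <;> fin_cases l <;>
        first
        | exact absurd rfl hne
        | exact Set.disjoint_empty _
        | exact Set.empty_disjoint _
        | (refine hdis ?_ ?_ ?_ <;> simp only [ne_eq, Sym2.eq_iff] <;> grind)
    · intro i j
      fin_cases i <;> fin_cases j
      · exact .of_adj huv.symm
      · exact hx'
      · exact hy'
      · exact hz'.symm
      · exact hl (by grind) (Ne.symm hz) (Ne.symm hx)
      · exact hl (by grind) (Ne.symm hz) (Ne.symm hy)
      · exact hw'.symm
      · exact hl (by grind) (Ne.symm hw) (Ne.symm hx)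
      · exact hl (by grind) (Ne.symm hw) (Ne.symm hy)
  · have hH : ∀ w, ∃ w', (completeBipartiteGraph (Fin 3) (Fin 3)).Adj w w' := by
      rintro (w | w)
      · exact ⟨.inr 0, by simp⟩
      · exact ⟨.inl 0, by simp⟩
    rcases M.of_contract huv hH with
      h | ⟨a, I, ha, hfv, hfI, hIv, hdis, hl, x, y, z, w, hx, hy, hz, hw, hnd, -⟩
    · exact Or.inr h
    · exfalso
      clear * - hx hy hz hw hnd
      simp only [completeBipartiteGraph_adj] at hx hy hz hw
      revert a x y z w
      decide +kernel

end Contract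

/-- Two adjacent vertices completely joined to a triangle with one edge replaced by a path. -/
theorem nonplanar_of_k5 {V : Type*} {G : SimpleGraph V} {v h p a b : V} {J : Set V}
    (hvh : G.Adj v h) (hvp : G.Adj v p)
    (hva : G.Adj v a) (hvb : G.Adj v b) (hhp : G.Adj h p) (hha : G.Adj h a) (hhb : G.Adj h b)
    (hpa : G.Adj p a) (hpb : G.Adj p b) (hab : a ≠ b) (hJ : v ∉ J ∧ h ∉ J ∧ p ∉ J ∧ a ∉ J ∧ b ∉ J)
    (hl : Linked G J a b) : Nonplanar G := by
  refine Or.inl ⟨![v, h, p, a, b], fun e => {x | x ∈ J ∧ e = s(3, 4)}, ?_, ?_, ?_, ?_⟩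
  · have := hvh.ne
    have := hvp.ne
    have := hva.ne
    have := hvb.ne
    have := hhp.ne
    have := hha.ne
    have := hhb.ne
    have := hpa.ne
    have := hpb.ne
    intro i j
    fin_cases i <;> fin_cases j <;> simp <;> tauto
  · rintro e w ⟨hw, -⟩
    fin_cases w <;> simp at hw <;> tauto
  · intro a b c d _ _ hne
    rw [Set.disjoint_left]
    rintro x ⟨-, e⟩ ⟨-, e'⟩
    exact hne (e.trans e'.symm)
  · have hl' : Linked G {x | x ∈ J ∧ (s(3, 4) : Sym2 (Fin 5)) = s(3, 4)} a b :=
      hl.mono fun x hx => ⟨hx, rfl⟩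
    have hl'' : Linked G {x | x ∈ J ∧ (s(4, 3) : Sym2 (Fin 5)) = s(3, 4)} b a :=
      hl.symm.mono fun x hx => ⟨hx, Sym2.eq_swap⟩
    intro i j hij
    fin_cases i <;> fin_cases j <;>
      first
      | exact absurd rfl hij
      | exact hl'
      | exact hl''
      | (refine Linked.of_adj ?_; first | assumption | (refine SimpleGraph.Adj.symm ?_; assumption))

/-- The vertices of `G` outside `S` are isolated. -/
def SupportedOn {V : Type*} (G : SimpleGraph V) (S : Finset V) : Prop :=
  ∀ a b, G.Adj a b → a ∈ S

open scoped Classical in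
theorem SupportedOn.contract {V : Type*} {G : SimpleGraph V} {S : Finset V}
    (hS : SupportedOn G S) {u v : V} (huv : G.Adj u v) :
    SupportedOn (contract G u v) (S.erase v) := by
  intro a b h
  obtain ⟨-, ha, -, h⟩ := contract_adj.mp h
  refine Finset.mem_erase.mpr ⟨ha, ?_⟩
  rcases h with h | ⟨rfl, -⟩ | ⟨-, h⟩
  · exact hS _ _ h
  · exact hS _ _ huv
  · exact hS _ _ h.symm

section Counting

open scoped Classical

variable {V : Type*} [Fintype V] {G : SimpleGraph V}

theorem card_edgeFinset_le_contract {u v : V} (huv : G.Adj u v) :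
    G.edgeFinset.card ≤
      (contract G u v).edgeFinset.card + (G.neighborFinset u ∩ G.neighborFinset v).card + 1 := by
  set C := G.neighborFinset u ∩ G.neighborFinset v with hC
  set D := (G.neighborFinset v \ G.neighborFinset u).erase u with hD
  set A := G.edgeFinset.filter (fun e => v ∉ e) with hA
  have h1 : G.edgeFinset ⊆ A ∪ ((insert u C).image (fun x => s(v, x)) ∪ D.image fun x => s(v, x)) := by
    intro e he
    by_cases hv : v ∈ e
    · obtain ⟨x, rfl⟩ := Sym2.mem_iff_exists.mp hv
      rw [SimpleGraph.mem_edgeFinset, SimpleGraph.mem_edgeSet] at he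
      rw [Finset.mem_union, ← Finset.image_union]
      refine Or.inr (Finset.mem_image_of_mem _ ?_)
      simp only [hC, hD, Finset.mem_union, Finset.mem_insert, Finset.mem_inter, Finset.mem_erase,
        Finset.mem_sdiff, SimpleGraph.mem_neighborFinset]
      tauto
    · exact Finset.mem_union_left _ (Finset.mem_filter.mpr ⟨he, hv⟩)
  have h2 : A ∪ D.image (fun x => s(u, x)) ⊆ (contract G u v).edgeFinset := by
    intro e he
    rw [SimpleGraph.mem_edgeFinset]
    rcases Finset.mem_union.mp he with he | he
    · obtain ⟨he, hv⟩ := Finset.mem_filter.mp he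
      induction e with
      | h a b =>
        rw [SimpleGraph.mem_edgeFinset, SimpleGraph.mem_edgeSet] at he
        rw [Sym2.mem_iff, not_or] at hv
        exact contract_adj.mpr ⟨he.ne, Ne.symm hv.1, Ne.symm hv.2, Or.inl he⟩
    · obtain ⟨x, hx, rfl⟩ := Finset.mem_image.mp he
      simp only [hD, Finset.mem_erase, Finset.mem_sdiff, SimpleGraph.mem_neighborFinset] at hx
      exact contract_adj.mpr ⟨hx.1.symm, huv.ne, hx.2.1.ne.symm, Or.inr (Or.inl ⟨rfl, hx.2.1⟩)⟩
  have h3 : Disjoint A (D.image fun x => s(u, x)) := by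
    rw [Finset.disjoint_left]
    intro e he he'
    obtain ⟨x, hx, rfl⟩ := Finset.mem_image.mp he'
    simp only [hD, Finset.mem_erase, Finset.mem_sdiff, SimpleGraph.mem_neighborFinset] at hx
    have := (Finset.mem_filter.mp he).1
    rw [SimpleGraph.mem_edgeFinset, SimpleGraph.mem_edgeSet] at this
    exact hx.2.2 this
  have h4 : (D.image fun x => s(u, x)).card = D.card :=
    Finset.card_image_of_injective _ fun x y h => Sym2.congr_right.mp h
  have := Finset.card_le_card h1
  have := Finset.card_le_card h2
  rw [Finset.card_union_of_disjoint h3, h4] at this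
  have := Finset.card_union_le A ((insert u C).image (fun x => s(v, x)) ∪ D.image fun x => s(v, x))
  have := Finset.card_union_le ((insert u C).image (fun x => s(v, x))) (D.image fun x => s(v, x))
  have : ((insert u C).image (fun x => s(v, x))).card ≤ _ := Finset.card_image_le
  have : (D.image (fun x => s(v, x))).card ≤ _ := Finset.card_image_le
  have := Finset.card_insert_le u C
  omega

theorem nonplanar_of_common_neighbors {v : V} (hne : (G.neighborFinset v).Nonempty)
    (hcard : (G.neighborFinset v).card ≤ 5)
    (h3 : ∀ u, G.Adj u v → 3 ≤ (G.neighborFinset u ∩ G.neighborFinset v).card) :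
    Nonplanar G := by
  by_cases hcomplete : ∀ a ∈ G.neighborFinset v, ∀ b ∈ G.neighborFinset v, a ≠ b → G.Adj a b
  · obtain ⟨a, ha⟩ := hne
    have hav : G.Adj v a := by simpa using ha
    obtain ⟨x, hx, y, hy, z, hz, hxy, hxz, hyz⟩ := Finset.two_lt_card.mp (h3 a hav.symm)
    simp only [Finset.mem_inter, SimpleGraph.mem_neighborFinset] at hx hy hz hcomplete
    have hyz' := hcomplete y hy.2 z hz.2 hyz
    exact nonplanar_of_k5 (J := ∅) hav hx.2 hy.2 hz.2 hx.1 hy.1 hz.1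
      (hcomplete x hx.2 y hy.2 hxy) (hcomplete x hx.2 z hz.2 hxz) hyz (by simp) (.of_adj hyz')
  · push Not at hcomplete
    obtain ⟨a, ha, b, hb, hab, hnab⟩ := hcomplete
    have hav : G.Adj v a := by simpa using ha
    have hbv : G.Adj v b := by simpa using hb
    set T := ((G.neighborFinset v).erase a).erase b with hT
    have hTcard : T.card ≤ 3 := by
      rw [hT, Finset.card_erase_of_mem (Finset.mem_erase.mpr ⟨hab.symm, hb⟩),
        Finset.card_erase_of_mem ha]
      omega
    have haT : G.neighborFinset a ∩ G.neighborFinset v = T := by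
      refine Finset.eq_of_subset_of_card_le (fun x hx => ?_) (hTcard.trans (h3 a hav.symm))
      simp only [Finset.mem_inter, SimpleGraph.mem_neighborFinset, hT, Finset.mem_erase] at hx ⊢
      exact ⟨fun e => hnab (e ▸ hx.1), hx.1.ne.symm, hx.2⟩
    have hbT : G.neighborFinset b ∩ G.neighborFinset v = T := by
      refine Finset.eq_of_subset_of_card_le (fun x hx => ?_) (hTcard.trans (h3 b hbv.symm))
      simp only [Finset.mem_inter, SimpleGraph.mem_neighborFinset, hT, Finset.mem_erase] at hx ⊢
      exact ⟨hx.1.ne.symm, fun e => hnab (e ▸ hx.1.symm), hx.2⟩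
    have hT3 : 3 ≤ T.card := haT ▸ h3 a hav.symm
    have hmem : ∀ x ∈ T, G.Adj a x ∧ G.Adj b x ∧ G.Adj v x := by
      intro x hx
      have h := haT.symm ▸ hx
      have h' := hbT.symm ▸ hx
      simp only [Finset.mem_inter, SimpleGraph.mem_neighborFinset] at h h'
      exact ⟨h.1, h'.1, h.2⟩
    obtain ⟨h, hh⟩ := Finset.card_pos.mp (by omega : 0 < T.card)
    have hhv := (hmem h hh).2.2
    obtain ⟨p, hp, hpT⟩ : ∃ p, G.Adj h p ∧ p ∈ T := by
      by_contra! hno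
      have hsub : G.neighborFinset h ∩ G.neighborFinset v ⊆ {a, b} := by
        intro x hx
        simp only [Finset.mem_inter, SimpleGraph.mem_neighborFinset] at hx
        have := hno x hx.1
        simp only [hT, Finset.mem_erase, SimpleGraph.mem_neighborFinset] at this
        simp only [Finset.mem_insert, Finset.mem_singleton]
        tauto
      have := (h3 h hhv.symm).trans (Finset.card_le_card hsub)
      have := Finset.card_le_two (a := a) (b := b)
      omega
    obtain ⟨q, hq⟩ : ((T.erase h).erase p).Nonempty := by
      rw [← Finset.card_pos, Finset.card_erase_of_mem (Finset.mem_erase.mpr ⟨hp.ne.symm, hpT⟩),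
        Finset.card_erase_of_mem hh]
      omega
    simp only [Finset.mem_erase] at hq
    obtain ⟨hqa, hqb, hqv⟩ := hmem q hq.2.2
    obtain ⟨hpa, hpb, hpv⟩ := hmem p hpT
    obtain ⟨hha, hhb, -⟩ := hmem h hh
    refine nonplanar_of_k5 (J := {q}) hhv hpv hav hbv hp hha.symm hhb.symm hpa.symm hpb.symm hab
      ?_ (((Linked.of_adj (I := ∅) hqb.symm).cons hqa).mono (by simp))
    simp only [Set.mem_singleton_iff]
    exact ⟨hqv.ne, Ne.symm hq.2.1, Ne.symm hq.1, hqa.ne, hqb.ne⟩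

theorem SupportedOn.sum_degree {S : Finset V} (hS : SupportedOn G S) :
    ∑ v ∈ S, (G.neighborFinset v).card = 2 * G.edgeFinset.card := by
  rw [← G.sum_degrees_eq_twice_card_edges]
  refine Finset.sum_subset (Finset.subset_univ S) fun v _ hv => ?_
  rw [Finset.card_eq_zero, Finset.eq_empty_iff_forall_notMem]
  intro x hx
  exact hv (hS v x (by simpa using hx))

theorem SupportedOn.exists_degree_le {S : Finset V} (hS : SupportedOn G S) {d : ℕ}
    (h : 2 * G.edgeFinset.card < (d + 1) * S.card) :
    ∃ v ∈ S, (G.neighborFinset v).card ≤ d := by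
  by_contra! hd
  have : ∑ v ∈ S, (d + 1) ≤ ∑ v ∈ S, (G.neighborFinset v).card := Finset.sum_le_sum hd
  rw [hS.sum_degree, Finset.sum_const, smul_eq_mul, mul_comm] at this
  omega

/-- Mader's argument for the edge bound. -/
theorem card_edgeFinset_le_of_not_nonplanar (k : ℕ) (hk : 3 ≤ k) :
    ∀ (G : SimpleGraph V) (S : Finset V), SupportedOn G S → S.card = k → ¬ Nonplanar G →
      G.edgeFinset.card ≤ 3 * k - 6 := by
  induction k, hk using Nat.le_induction with
  | base =>
    intro G S hS hk _
    have : ∑ v ∈ S, (G.neighborFinset v).card ≤ ∑ v ∈ S, 2 := by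
      refine Finset.sum_le_sum fun v hv => ?_
      have : G.neighborFinset v ⊆ S.erase v := by
        intro x hx
        rw [SimpleGraph.mem_neighborFinset] at hx
        exact Finset.mem_erase.mpr ⟨hx.ne.symm, hS _ _ hx.symm⟩
      have := Finset.card_le_card this
      rw [Finset.card_erase_of_mem hv] at this
      omega
    rw [hS.sum_degree, Finset.sum_const, hk, smul_eq_mul] at this
    omega
  | succ k hk ih =>
    intro G S hS hc hG
    by_contra! hE
    obtain ⟨E, hEsub, hEcard⟩ := Finset.exists_subset_card_eq (s := G.edgeFinset)
      (n := 3 * (k + 1) - 5) (by omega)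
    obtain ⟨H, hH⟩ : ∃ H, H = SimpleGraph.fromEdgeSet (E : Set (Sym2 V)) := ⟨_, rfl⟩
    have hle : H ≤ G := by
      intro a b h
      rw [hH, SimpleGraph.fromEdgeSet_adj] at h
      simpa using hEsub h.1
    have hHE : H.edgeFinset = E := by
      ext e
      rw [SimpleGraph.mem_edgeFinset, hH, SimpleGraph.edgeSet_fromEdgeSet]
      simp only [Set.mem_sdiff, Finset.mem_coe, and_iff_left_iff_imp]
      intro he
      exact G.not_isDiag_of_mem_edgeFinset (hEsub he)
    have hHS : SupportedOn H S := fun a b h => hS a b (hle h)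
    have hHn : ¬ Nonplanar H := fun h => hG (h.mono hle)
    obtain ⟨v, hv, hdeg⟩ := hHS.exists_degree_le (d := 5) (by rw [hHE, hEcard, hc]; omega)
    by_cases hne : (H.neighborFinset v).Nonempty
    · refine hHn (nonplanar_of_common_neighbors hne hdeg fun u huv => ?_)
      by_contra! hlt
      have h1 := card_edgeFinset_le_contract huv
      have h2 := ih _ _ (hHS.contract huv) (by rw [Finset.card_erase_of_mem hv, hc]; omega)
        fun h => hHn (h.of_contract huv)
      rw [hHE, hEcard] at h1
      omega
    · have := ih H (S.erase v) (fun a b h => Finset.mem_erase.mpr ⟨?_, hHS a b h⟩)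
        (by rw [Finset.card_erase_of_mem hv, hc]; omega) hHn
      · rw [hHE, hEcard] at this
        omega
      · rintro rfl
        exact hne ⟨b, by simpa using h⟩

end Counting

/-- `G` has an induced path on five vertices. -/
def HasInducedP5 {V : Type*} (G : SimpleGraph V) : Prop :=
  ∃ a b c d e, G.Adj a b ∧ G.Adj b c ∧ G.Adj c d ∧ G.Adj d e ∧ ¬ G.Adj a c ∧ ¬ G.Adj a d ∧
    ¬ G.Adj a e ∧ ¬ G.Adj b d ∧ ¬ G.Adj b e ∧ ¬ G.Adj c e

theorem HasInducedP5.containsInduced {V : Type*} {G : SimpleGraph V} (h : HasInducedP5 G) :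
    ContainsInduced (SimpleGraph.pathGraph 5) G := by
  obtain ⟨a, b, c, d, e, hab, hbc, hcd, hde, hac, had, hae, hbd, hbe, hce⟩ := h
  have hadj : ∀ i j : Fin 5, G.Adj (![a, b, c, d, e] i) (![a, b, c, d, e] j) ↔
      (SimpleGraph.pathGraph 5).Adj i j := by
    intro i j
    rw [SimpleGraph.pathGraph_adj]
    fin_cases i <;> fin_cases j <;> simp <;> first | assumption | (rw [G.adj_comm]; assumption)
  have hinj : Function.Injective ![a, b, c, d, e] := by
    intro i j hij
    have : ∀ i j : Fin 5, (∀ k, (SimpleGraph.pathGraph 5).Adj i k ↔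
        (SimpleGraph.pathGraph 5).Adj j k) → i = j := by
      simp only [SimpleGraph.pathGraph_adj]
      decide
    exact this i j fun k => by rw [← hadj, ← hadj, hij]
  exact ⟨Set.range ![a, b, c, d, e], ⟨⟨Equiv.ofInjective _ hinj, fun {i j} => hadj i j⟩⟩⟩

theorem HasInducedP5.of_contract {V : Type*} {G : SimpleGraph V} {u v : V} (huv : G.Adj u v)
    (h : HasInducedP5 (contract G u v)) : HasInducedP5 G := by
  by_contra hG
  have hno : ∀ a b c d e, G.Adj a b → G.Adj b c → G.Adj c d → G.Adj d e → ¬ G.Adj a c →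
    ¬ G.Adj a d → ¬ G.Adj a e → ¬ G.Adj b d → ¬ G.Adj b e → ¬ G.Adj c e → False :=
    fun a b c d e h1 h2 h3 h4 h5 h6 h7 h8 h9 h10 =>
      hG ⟨a, b, c, d, e, h1, h2, h3, h4, h5, h6, h7, h8, h9, h10⟩
  have hG' : ∀ {x y}, (contract G u v).Adj x y → x ≠ u → y ≠ u → G.Adj x y := by
    intro x y hxy
    rw [contract_adj] at hxy
    tauto
  have hu : ∀ {y}, (contract G u v).Adj u y → y ≠ u ∧ (G.Adj u y ∨ G.Adj v y) := by
    intro y hxy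
    rw [contract_adj] at hxy
    have := hxy.1
    exact ⟨hxy.1.symm, by tauto⟩
  have hv : ∀ {x y}, (contract G u v).Adj x y → x ≠ v ∧ y ≠ v := fun hxy => by
    rw [contract_adj] at hxy
    tauto
  have hn : ∀ {x y}, ¬ (contract G u v).Adj x y → x ≠ v → y ≠ v → ¬ G.Adj x y :=
    fun hxy hx hy hxy' => hxy (contract_adj.mpr ⟨hxy'.ne, hx, hy, Or.inl hxy'⟩)
  have hnu : ∀ {y}, ¬ (contract G u v).Adj u y → y ≠ u → y ≠ v → ¬ G.Adj u y ∧ ¬ G.Adj v y :=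
    fun hxy hyu hy => ⟨hn hxy huv.ne hy, fun h' =>
      hxy (contract_adj.mpr ⟨hyu.symm, huv.ne, hy, Or.inr (Or.inl ⟨rfl, h'⟩)⟩)⟩
  have hs := G.adj_comm
  have hs' := (contract G u v).adj_comm
  have key : ∀ a b c d e, (contract G u v).Adj a b → (contract G u v).Adj b c →
      (contract G u v).Adj c d → (contract G u v).Adj d e → ¬ (contract G u v).Adj a c →
      ¬ (contract G u v).Adj a d → ¬ (contract G u v).Adj a e → ¬ (contract G u v).Adj b d →
      ¬ (contract G u v).Adj b e → ¬ (contract G u v).Adj c e → a = u ∨ b = u ∨ c = u → False := by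
    rintro a b c d e hab hbc hcd hde hac had hae hbd hbe hce (rfl | rfl | rfl)
    · have hca : c ≠ a := by rintro rfl; exact had hcd
      have hda : d ≠ a := by rintro rfl; exact hac hcd.symm
      have hea : e ≠ a := by rintro rfl; exact had hde.symm
      have hba := hu hab
      have h1 := hnu hac hca (hv hcd).1
      have h2 := hnu had hda (hv hcd).2
      have h3 := hnu hae hea (hv hde).2
      have h4 := hG' hbc hba.1 hca
      have h5 := hG' hcd hca hda
      have h6 := hG' hde hda hea
      have h7 := hn hbd (hv hab).2 (hv hde).1
      have h8 := hn hbe (hv hab).2 (hv hde).2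
      have h9 := hn hce (hv hbc).2 (hv hde).2
      rcases hba.2 with h | h
      · exact hno a b c d e h h4 h5 h6 h1.1 h2.1 h3.1 h7 h8 h9
      · exact hno v b c d e h h4 h5 h6 h1.2 h2.2 h3.2 h7 h8 h9
    · have hdb : d ≠ b := by rintro rfl; exact hbe hde
      have heb : e ≠ b := by rintro rfl; exact hbd hde.symm
      have hca := hu hbc
      have haa := hu hab.symm
      have h1 := hnu hbd hdb (hv hde).1
      have h2 := hnu hbe heb (hv hde).2
      have h5 := hG' hcd hca.1 hdb
      have h6 := hG' hde hdb heb
      have h3 := hn hac (hv hab).1 (hv hbc).2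
      have h4 := hn had (hv hab).1 (hv hde).1
      have h7 := hn hae (hv hab).1 (hv hde).2
      have h9 := hn hce (hv hbc).2 (hv hde).2
      have i1 := hno a b c d e
      have i2 := hno a v c d e
      have i3 := hno a b v c d
      have i4 := hno a v b c d
      simp only [hs a b, hs a v, hs v b] at *
      clear hs hs' hnu hn hv hu hG' hno
      grind
    · have hac' : a ≠ c := by rintro rfl; exact had hcd
      have hec : e ≠ c := by rintro rfl; exact hbe hbc
      have hb := hu hbc.symm
      have hd := hu hcd
      have h1 := hnu (y := a) (by rwa [hs']) hac' (hv hab).1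
      have h2 := hnu hce hec (hv hde).2
      have h5 := hG' hab hac' hb.1
      have h6 := hG' hde hd.1 hec
      have h4 := hn had (hv hab).1 (hv hde).1
      have h7 := hn hae (hv hab).1 (hv hde).2
      have h8 := hn hbd (hv hab).2 (hv hde).1
      have h9 := hn hbe (hv hab).2 (hv hde).2
      have i1 := hno a b c d e
      have i2 := hno a b v d e
      have i3 := hno a b c v d
      have i4 := hno a b v c d
      simp only [hs b c, hs b v, hs v c, hs a c, hs a v] at *
      clear hs hs' hnu hn hv hu hG' hno
      grind
  obtain ⟨a, b, c, d, e, hab, hbc, hcd, hde, hac, had, hae, hbd, hbe, hce⟩ := h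
  have k1 := key a b c d e hab hbc hcd hde hac had hae hbd hbe hce
  have k2 := key e d c b a hde.symm hcd.symm hbc.symm hab.symm (by rwa [hs']) (by rwa [hs'])
    (by rwa [hs']) (by rwa [hs']) (by rwa [hs']) (by rwa [hs'])
  simp only [imp_false, not_or] at k1 k2
  exact hno a b c d e (hG' hab k1.1 k1.2.1) (hG' hbc k1.2.1 k1.2.2) (hG' hcd k1.2.2 k2.2.1)
    (hG' hde k2.2.1 k2.1) (hn hac (hv hab).1 (hv hbc).2) (hn had (hv hab).1 (hv hde).1)
    (hn hae (hv hab).1 (hv hde).2) (hn hbd (hv hab).2 (hv hde).1) (hn hbe (hv hab).2 (hv hde).2)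
    (hn hce (hv hbc).2 (hv hde).2)

section Good

open scoped Classical

variable {V : Type*} [Fintype V] {G : SimpleGraph V} {S : Finset V}

/-- `G` restricted to `S` is a triangulation without induced `P₅`. -/
structure IsP5FreeTriangulation (G : SimpleGraph V) (S : Finset V) : Prop where
  supportedOn : SupportedOn G S
  not_nonplanar : ¬ Nonplanar G
  card_edges : G.edgeFinset.card + 6 = 3 * S.card
  not_hasInducedP5 : ¬ HasInducedP5 G

namespace IsP5FreeTriangulation

theorem two_le_card_common (h : IsP5FreeTriangulation G S) (hS : 4 ≤ S.card) {u v : V}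
    (huv : G.Adj u v) : 2 ≤ (G.neighborFinset u ∩ G.neighborFinset v).card := by
  have h1 := card_edgeFinset_le_contract huv
  have hcard := Finset.card_erase_of_mem (h.supportedOn v u huv.symm)
  have h2 := card_edgeFinset_le_of_not_nonplanar (S.card - 1) (by omega) _ _
    (h.supportedOn.contract huv) hcard fun h' => h.not_nonplanar (h'.of_contract huv)
  have := h.card_edges
  omega

theorem exists_contract (h : IsP5FreeTriangulation G S) (hS : 4 ≤ S.card) {v : V}
    (hv : v ∈ S) (hd : (G.neighborFinset v).card ≤ 5) :
    ∃ u, G.Adj u v ∧ (G.neighborFinset u ∩ G.neighborFinset v).card = 2 ∧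
      IsP5FreeTriangulation (contract G u v) (S.erase v) := by
  have hE := h.card_edges
  have hcard := Finset.card_erase_of_mem hv
  have hne : (G.neighborFinset v).Nonempty := by
    by_contra hne
    have := card_edgeFinset_le_of_not_nonplanar (S.card - 1) (by omega) G (S.erase v)
      (fun a b hab => Finset.mem_erase.mpr ⟨?_, h.supportedOn a b hab⟩) hcard h.not_nonplanar
    · omega
    · rintro rfl
      exact hne ⟨b, by simpa using hab⟩
  obtain ⟨u, huv, hlt⟩ : ∃ u, G.Adj u v ∧
      (G.neighborFinset u ∩ G.neighborFinset v).card < 3 := by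
    by_contra! h3
    exact h.not_nonplanar (nonplanar_of_common_neighbors hne hd h3)
  have h2 := h.two_le_card_common hS huv
  have h1 := card_edgeFinset_le_contract huv
  have hn : ¬ Nonplanar (contract G u v) := fun h' => h.not_nonplanar (h'.of_contract huv)
  have h3 := card_edgeFinset_le_of_not_nonplanar (S.card - 1) (by omega) _ _
    (h.supportedOn.contract huv) hcard hn
  exact ⟨u, huv, by omega, h.supportedOn.contract huv, hn, by omega,
    fun h' => h.not_hasInducedP5 (h'.of_contract huv)⟩

/-- Below twelve vertices there is a vertex of degree three or four whose removal, after
adding a diagonal in the case of degree four, leaves a triangulation. -/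
theorem exists_reduction (h : IsP5FreeTriangulation G S) (hS : 4 ≤ S.card) (hS' : S.card < 12) :
    ∃ v ∈ S, ∃ u, G.Adj u v ∧ IsP5FreeTriangulation (contract G u v) (S.erase v) ∧
      ∃ x y, x ≠ y ∧ G.Adj u x ∧ G.Adj u y ∧
        (G.Adj x y ∧ (∀ z, G.Adj v z ↔ z = u ∨ z = x ∨ z = y) ∨
          ∃ b, u ≠ b ∧ ¬ G.Adj u b ∧ G.Adj b x ∧ G.Adj b y ∧
            ∀ z, G.Adj v z ↔ z = u ∨ z = b ∨ z = x ∨ z = y) := by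
  have hE := h.card_edges
  obtain ⟨v, hv, hd⟩ := h.supportedOn.exists_degree_le (d := 4) (by omega)
  obtain ⟨u, huv, h2, hc⟩ := h.exists_contract hS hv (by omega)
  refine ⟨v, hv, u, huv, hc, ?_⟩
  obtain ⟨x, y, hxy, hC⟩ := Finset.card_eq_two.mp h2
  have hmem : ∀ z, G.Adj u z ∧ G.Adj v z ↔ z = x ∨ z = y := fun z => by
    simpa using congrArg (z ∈ ·) hC
  obtain ⟨hux, hvx⟩ := (hmem x).mpr (Or.inl rfl)
  obtain ⟨huy, hvy⟩ := (hmem y).mpr (Or.inr rfl)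
  refine ⟨x, y, hxy, hux, huy, ?_⟩
  have hpair : ∀ {w p q}, G.Adj v w → (∀ z, G.Adj w z → G.Adj v z → z = p ∨ z = q) →
      G.Adj w p ∧ G.Adj w q := by
    intro w p q hw hz
    have hsub : G.neighborFinset w ∩ G.neighborFinset v ⊆ {p, q} := by
      intro z hz'
      simp only [Finset.mem_inter, SimpleGraph.mem_neighborFinset] at hz'
      simpa using hz z hz'.1 hz'.2
    have heq := Finset.eq_of_subset_of_card_le hsub
      (Finset.card_le_two.trans (h.two_le_card_common hS hw.symm))
    have hp : p ∈ ({p, q} : Finset V) := by simp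
    have hq : q ∈ ({p, q} : Finset V) := by simp
    rw [← heq] at hp hq
    simp only [Finset.mem_inter, SimpleGraph.mem_neighborFinset] at hp hq
    exact ⟨hp.1, hq.1⟩
  have hsub : {u, x, y} ⊆ G.neighborFinset v := by
    intro z
    simp only [Finset.mem_insert, Finset.mem_singleton, SimpleGraph.mem_neighborFinset]
    rintro (rfl | rfl | rfl)
    exacts [huv.symm, hvx, hvy]
  have hc3 : ({u, x, y} : Finset V).card = 3 :=
    Finset.card_eq_three.mpr ⟨u, x, y, hux.ne, huy.ne, hxy, rfl⟩
  by_cases hb : ∃ b, G.Adj v b ∧ b ∉ ({u, x, y} : Finset V)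
  · obtain ⟨b, hvb, hb⟩ := hb
    have heq : insert b {u, x, y} = G.neighborFinset v := by
      refine Finset.eq_of_subset_of_card_le
        (Finset.insert_subset (by simpa using hvb) hsub) ?_
      rw [Finset.card_insert_of_notMem hb, hc3]
      exact hd
    have hN : ∀ z, G.Adj v z ↔ z = b ∨ z = u ∨ z = x ∨ z = y := fun z => by
      simpa using congrArg (z ∈ ·) heq.symm
    simp only [Finset.mem_insert, Finset.mem_singleton, not_or] at hb
    have hub : ¬ G.Adj u b := fun h' => by
      have := (hmem b).mp ⟨h', hvb⟩
      tauto
    obtain ⟨hbx, hby⟩ := hpair (p := x) (q := y) hvb fun z hbz hvz => by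
      rcases (hN z).mp hvz with rfl | rfl | h' | h'
      · exact absurd rfl hbz.ne
      · exact absurd hbz.symm hub
      · exact Or.inl h'
      · exact Or.inr h'
    exact Or.inr ⟨b, Ne.symm hb.1, hub, hbx, hby, fun z => by rw [hN]; tauto⟩
  · push Not at hb
    have hN : ∀ z, G.Adj v z ↔ z = u ∨ z = x ∨ z = y := fun z =>
      ⟨fun h' => by simpa using hb z h', fun h' => by simpa using hsub (by simpa using h')⟩
    refine Or.inl ⟨(hpair (p := u) (q := y) hvx fun z hxz hvz => ?_).2, hN⟩
    rcases (hN z).mp hvz with h' | rfl | h'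
    · exact Or.inl h'
    · exact absurd rfl hxz.ne
    · exact Or.inr h'

end IsP5FreeTriangulation

end Good

section Search

/-! Boolean connectives and searches defined by bare recursors, so that the kernel evaluates them
quickly and lazily. -/

noncomputable def andThen (b c : Bool) : Bool := Bool.rec false c b

noncomputable def orElse (b c : Bool) : Bool := Bool.rec c true b

noncomputable def notThen (b c : Bool) : Bool := Bool.rec c false b

noncomputable def boolEq (b c : Bool) : Bool := Bool.rec (notThen c true) c b

noncomputable def anyBelow (n : ℕ) (f : ℕ → Bool) : Bool :=
  Nat.rec false (fun i r => Bool.rec r true (f i)) n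

noncomputable def allBelow (n : ℕ) (f : ℕ → Bool) : Bool :=
  Nat.rec true (fun i r => Bool.rec false r (f i)) n

noncomputable def anyIn {α : Type*} (l : List α) (f : α → Bool) : Bool :=
  List.rec false (fun a _ r => Bool.rec r true (f a)) l

noncomputable def allIn {α : Type*} (l : List α) (f : α → Bool) : Bool :=
  List.rec true (fun a _ r => Bool.rec false r (f a)) l

noncomputable def nth {α : Type*} (d : α) (l : List α) : ℕ → α :=
  List.rec (fun _ => d) (fun a _ r i => Nat.rec a (fun i _ => r i) i) l

theorem andThen_eq_true {b c : Bool} : andThen b c = true ↔ b = true ∧ c = true := by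
  cases b <;> cases c <;> decide

theorem orElse_eq_true {b c : Bool} : orElse b c = true ↔ b = true ∨ c = true := by
  cases b <;> cases c <;> decide

theorem notThen_eq_true {b c : Bool} : notThen b c = true ↔ ¬ b = true ∧ c = true := by
  cases b <;> cases c <;> decide

theorem boolEq_eq_true {b c : Bool} : boolEq b c = true ↔ b = c := by
  cases b <;> cases c <;> decide

theorem anyBelow_eq_true {n : ℕ} {f : ℕ → Bool} :
    anyBelow n f = true ↔ ∃ i < n, f i = true := by
  induction n with
  | zero => simp [anyBelow]
  | succ n ih =>
    have : anyBelow (n + 1) f = orElse (f n) (anyBelow n f) := rfl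
    rw [this, orElse_eq_true, ih, Nat.exists_lt_succ_right, or_comm]

theorem allBelow_eq_true {n : ℕ} {f : ℕ → Bool} :
    allBelow n f = true ↔ ∀ i < n, f i = true := by
  induction n with
  | zero => simp [allBelow]
  | succ n ih =>
    have : allBelow (n + 1) f = andThen (f n) (allBelow n f) := rfl
    rw [this, andThen_eq_true, ih, Nat.forall_lt_succ_right, and_comm]

theorem anyIn_eq_true {α : Type*} {l : List α} {f : α → Bool} :
    anyIn l f = true ↔ ∃ a ∈ l, f a = true := by
  induction l with
  | nil => simp [anyIn]
  | cons a l ih =>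
    have : anyIn (a :: l) f = orElse (f a) (anyIn l f) := rfl
    simp [this, orElse_eq_true, ih]

theorem allIn_eq_true {α : Type*} {l : List α} {f : α → Bool} :
    allIn l f = true ↔ ∀ a ∈ l, f a = true := by
  induction l with
  | nil => simp [allIn]
  | cons a l ih =>
    have : allIn (a :: l) f = andThen (f a) (allIn l f) := rfl
    simp [this, andThen_eq_true, ih]

noncomputable def isMember (l : List ℕ) (i : ℕ) : Bool := anyIn l (Nat.beq i)

theorem isMember_eq_true {l : List ℕ} {i : ℕ} : isMember l i = true ↔ i ∈ l := by
  simp [isMember, anyIn_eq_true]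

/-- The adjacency relation on `ℕ` whose lists of smaller neighbours are given by `rows`. -/
noncomputable def ofRows (rows : List (List ℕ)) (i j : ℕ) : Bool :=
  orElse (isMember (nth [] rows i) j) (isMember (nth [] rows j) i)

/-- Add a vertex `k` with neighbours `nb` and delete the edges inside `rem`. -/
noncomputable def addVertex (k : ℕ) (A : ℕ → ℕ → Bool) (nb rem : List ℕ) (i j : ℕ) : Bool :=
  Bool.rec
    (Bool.rec (andThen (A i j) (notThen (andThen (isMember rem i) (isMember rem j)) true))
      (isMember nb i) (Nat.beq j k))
    (isMember nb j) (Nat.beq i k)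

/-- Search for an induced `P₅` on the vertices below `n`. -/
noncomputable def findP5 (n : ℕ) (A : ℕ → ℕ → Bool) : Bool :=
  anyBelow n fun a => anyBelow n fun b => andThen (A a b) <|
    anyBelow n fun c => andThen (A b c) <| notThen (A a c) <|
      anyBelow n fun d => andThen (A c d) <| notThen (A a d) <| notThen (A b d) <|
        anyBelow n fun e => andThen (A d e) <| notThen (A a e) <| notThen (A b e) <|
          notThen (A c e) true

/-- Search below `n` for a `K₃,₃` in which at most one edge is subdivided, once. -/
noncomputable def findK33 (n : ℕ) (A : ℕ → ℕ → Bool) : Bool :=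
  anyBelow n fun y => anyBelow y fun x =>
    anyBelow n fun b => andThen (A x b) <| andThen (A y b) <|
      anyBelow b fun a => andThen (A x a) <| andThen (A y a) <|
        anyBelow n fun z => andThen (A z a) <| andThen (A z b) <|
          notThen (Nat.beq z x) <| notThen (Nat.beq z y) <|
          anyBelow n fun c => andThen (A x c) <| andThen (A y c) <|
            notThen (Nat.beq c a) <| notThen (Nat.beq c b) <| notThen (Nat.beq c z) <|
            orElse (A z c) <| anyBelow n fun w => andThen (A z w) <| andThen (A w c) <|
              notThen (Nat.beq w x) <| notThen (Nat.beq w y) <| notThen (Nat.beq w a) <|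
              notThen (Nat.beq w b) true

/-- `l` lists the images of an isomorphism from `B` to `A`. -/
noncomputable def isIso (n : ℕ) (A B : ℕ → ℕ → Bool) (l : List ℕ) : Bool :=
  allBelow n fun i => andThen (Nat.blt (nth 0 l i) n) <| allBelow n fun j =>
    andThen (boolEq (B i j) (A (nth 0 l i) (nth 0 l j))) <|
      orElse (Nat.beq i j) <| notThen (Nat.beq (nth 0 l i) (nth 0 l j)) true

/-- Backtracking search for an isomorphism from `B` to `A` extending the partial map `l`, with
`m` values still to be chosen. -/
noncomputable def findIso (n : ℕ) (A B : ℕ → ℕ → Bool) (m : ℕ) : List ℕ → Bool :=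
  Nat.rec (isIso n A B)
    (fun m r l => anyBelow n fun x => notThen (isMember l x) <|
      andThen (allBelow (n - m - 1) fun j => boolEq (B (n - m - 1) j) (A x (nth 0 l j))) <|
        r (l ++ [x])) m

/-- `A` is excluded or isomorphic to a member of `L`. -/
noncomputable def isSettled (n : ℕ) (A : ℕ → ℕ → Bool) (L : List (List (List ℕ))) : Bool :=
  orElse (findP5 n A) <| orElse (findK33 n A) <|
    anyIn L fun rows => findIso n A (ofRows rows) n []

/-- Every way of adding a vertex of degree three or four to a member of `L` leads to an excluded
graph or to a member of `L'`. -/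
noncomputable def isCovered (k : ℕ) (L L' : List (List (List ℕ))) : Bool :=
  allIn L fun rows => allBelow k fun i => allBelow i fun j =>
    orElse (notThen (ofRows rows i j) true) <| allBelow k fun p =>
      orElse (notThen (andThen (ofRows rows i p) (ofRows rows j p)) true) <| andThen
        (orElse (notThen (Nat.blt p j) true) <|
          isSettled (k + 1) (addVertex k (ofRows rows) [i, j, p] []) L')
        (allBelow p fun q =>
          orElse (notThen (andThen (ofRows rows i q) (ofRows rows j q)) true) <|
            isSettled (k + 1) (addVertex k (ofRows rows) [i, j, p, q] [i, j]) L')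

theorem exists_isIso_of_findIso {n : ℕ} {A B : ℕ → ℕ → Bool} {m : ℕ} {l : List ℕ}
    (h : findIso n A B m l = true) : ∃ l, isIso n A B l = true := by
  induction m generalizing l with
  | zero => exact ⟨l, h⟩
  | succ m ih =>
    obtain ⟨x, -, hx⟩ := anyBelow_eq_true.mp h
    exact ih (andThen_eq_true.mp (notThen_eq_true.mp hx).2).2

theorem addVertex_left {k : ℕ} {A : ℕ → ℕ → Bool} {nb rem : List ℕ} {j : ℕ} :
    addVertex k A nb rem k j = true ↔ j ∈ nb := by
  have : addVertex k A nb rem k j = isMember nb j := by simp [addVertex]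
  rw [this, isMember_eq_true]

theorem addVertex_right {k : ℕ} {A : ℕ → ℕ → Bool} {nb rem : List ℕ} {i : ℕ} (hi : i ≠ k) :
    addVertex k A nb rem i k = true ↔ i ∈ nb := by
  have : addVertex k A nb rem i k = isMember nb i := by
    simp [addVertex, Bool.eq_false_iff.mpr (mt Nat.eq_of_beq_eq_true hi)]
  rw [this, isMember_eq_true]

theorem addVertex_of_ne {k : ℕ} {A : ℕ → ℕ → Bool} {nb rem : List ℕ} {i j : ℕ} (hi : i ≠ k)
    (hj : j ≠ k) : addVertex k A nb rem i j = true ↔ A i j = true ∧ ¬ (i ∈ rem ∧ j ∈ rem) := by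
  have : addVertex k A nb rem i j =
      andThen (A i j) (notThen (andThen (isMember rem i) (isMember rem j)) true) := by
    simp [addVertex, Bool.eq_false_iff.mpr (mt Nat.eq_of_beq_eq_true hi),
      Bool.eq_false_iff.mpr (mt Nat.eq_of_beq_eq_true hj)]
  simp [this, andThen_eq_true, notThen_eq_true, isMember_eq_true]

end Search

/-- On the vertices below `k`, the relation `A` describes `G` restricted to `S`. -/
structure Represents {V : Type*} (k : ℕ) (A : ℕ → ℕ → Bool) (φ : ℕ → V) (G : SimpleGraph V)
    (S : Finset V) : Prop where
  mem : ∀ i < k, φ i ∈ S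
  inj : ∀ i < k, ∀ j < k, φ i = φ j → i = j
  adj : ∀ i < k, ∀ j < k, G.Adj (φ i) (φ j) ↔ A i j = true

namespace Represents

variable {V : Type*} {k : ℕ} {A B : ℕ → ℕ → Bool} {φ : ℕ → V} {G : SimpleGraph V} {S : Finset V}

theorem exists_eq (h : Represents k A φ G S) (hS : S.card = k) {x : V} (hx : x ∈ S) :
    ∃ i < k, φ i = x := by
  obtain ⟨i, hi, rfl⟩ := Finset.surj_on_of_inj_on_of_card_le (s := Finset.range k) (t := S)
    (fun i _ => φ i) (fun i hi => h.mem i (Finset.mem_range.mp hi))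
    (fun i j hi hj => h.inj i (Finset.mem_range.mp hi) j (Finset.mem_range.mp hj))
    (by simp [hS]) x hx
  exact ⟨i, Finset.mem_range.mp hi, rfl⟩

theorem hasInducedP5 (h : Represents k A φ G S) (hA : findP5 k A = true) : HasInducedP5 G := by
  simp only [findP5, anyBelow_eq_true, andThen_eq_true, notThen_eq_true] at hA
  obtain ⟨a, ha, b, hb, hab, c, hc, hbc, hac, d, hd, hcd, had, hbd, e, he, hde, hae, hbe, hce, -⟩ :=
    hA
  refine ⟨φ a, φ b, φ c, φ d, φ e, ?_⟩
  simp_all [h.adj]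

theorem nonplanar (h : Represents k A φ G S) (hA : findK33 k A = true) : Nonplanar G := by
  simp only [findK33, anyBelow_eq_true, andThen_eq_true, notThen_eq_true, Nat.beq_eq,
    orElse_eq_true] at hA
  obtain ⟨y, hy, x, hx, b, hb, hxb, hyb, a, ha, hxa, hya, z, hz, hza, hzb, hzx, hzy, c, hc, hxc,
    hyc, hca, hcb, hcz, hlink⟩ := hA
  have hx' := hx.trans hy
  have ha' := ha.trans hb
  have hne : ∀ {i j}, i < k → j < k → i ≠ j → φ i ≠ φ j := fun hi hj hij h' =>
    hij (h.inj _ hi _ hj h')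
  have hadj : ∀ {i j}, i < k → j < k → A i j = true → G.Adj (φ i) (φ j) := fun hi hj =>
    (h.adj _ hi _ hj).mpr
  obtain ⟨I, hI, hzc⟩ : ∃ I : Set V, (φ x ∉ I ∧ φ y ∉ I ∧ φ z ∉ I ∧ φ a ∉ I ∧ φ b ∉ I ∧ φ c ∉ I) ∧
      Linked G I (φ z) (φ c) := by
    rcases hlink with hzc | ⟨w, hw, hzw, hwc, hwx, hwy, hwa, hwb, -⟩
    · exact ⟨∅, by simp, Linked.of_adj (hadj hz hc hzc)⟩
    · have h1 := hadj hz hw hzw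
      have h2 := hadj hw hc hwc
      refine ⟨insert (φ w) ∅, ?_, Linked.cons h1 (Linked.of_adj h2)⟩
      simp only [insert_empty_eq, Set.mem_singleton_iff]
      exact ⟨hne hx' hw (Ne.symm hwx), hne hy hw (Ne.symm hwy), h1.ne,
        hne ha' hw (Ne.symm hwa), hne hb hw (Ne.symm hwb), h2.ne.symm⟩
  have e1 := hadj hx' ha' hxa
  have e2 := hadj hx' hb hxb
  have e3 := hadj hx' hc hxc
  have e4 := hadj hy ha' hya
  have e5 := hadj hy hb hyb
  have e6 := hadj hy hc hyc
  have e7 := hadj hz ha' hza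
  have e8 := hadj hz hb hzb
  have n1 := hne hx' hy hx.ne
  have n2 := hne hz hx' hzx
  have n3 := hne hz hy hzy
  have n4 := hne ha' hb ha.ne
  have n5 := hne hc ha' hca
  have n6 := hne hc hb hcb
  have n7 := hne hc hz hcz
  refine nonplanar_of_bipartite ![φ x, φ y, φ z] ![φ a, φ b, φ c]
    (fun i j => if i = 2 ∧ j = 2 then I else ∅) ?_ ?_ ?_ ?_ ?_ ?_ ?_
  · intro i j hij
    fin_cases i <;> fin_cases j <;> first
      | rfl
      | exact absurd hij n1
      | exact absurd hij.symm n1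
      | exact absurd hij n2
      | exact absurd hij.symm n2
      | exact absurd hij n3
      | exact absurd hij.symm n3
  · intro i j hij
    fin_cases i <;> fin_cases j <;> first
      | rfl
      | exact absurd hij n4
      | exact absurd hij.symm n4
      | exact absurd hij n5
      | exact absurd hij.symm n5
      | exact absurd hij n6
      | exact absurd hij.symm n6
  · intro i j
    fin_cases i <;> fin_cases j <;> simp <;> first | exact SimpleGraph.Adj.ne ‹_› | exact n7.symm
  · intro i j l
    split_ifs
    · fin_cases i <;> simp [hI]
    · simp
  · intro i j l
    split_ifs
    · fin_cases i <;> simp [hI]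
    · simp
  · intro i j i' j' hij
    split_ifs with h1 h2
    · exact absurd (Prod.ext (h1.1.trans h2.1.symm) (h1.2.trans h2.2.symm)) hij
    all_goals simp
  · intro i j
    fin_cases i <;> fin_cases j <;> first | exact hzc | exact Linked.of_adj ‹_›

theorem comp (h : Represents k A φ G S) {l : List ℕ} (hl : isIso k A B l = true) :
    Represents k B (φ ∘ nth 0 l) G S := by
  simp only [isIso, allBelow_eq_true, andThen_eq_true, orElse_eq_true, notThen_eq_true,
    boolEq_eq_true, Nat.beq_eq, Nat.blt_eq] at hl
  refine ⟨fun i hi => h.mem _ (hl i hi).1, fun i hi j hj hij => ?_, fun i hi j hj => ?_⟩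
  · exact ((hl i hi).2 j hj).2.resolve_right fun h' =>
      h'.1 (h.inj _ (hl i hi).1 _ (hl j hj).1 hij)
  · rw [((hl i hi).2 j hj).1]
    exact h.adj _ (hl i hi).1 _ (hl j hj).1

theorem exists_of_isSettled (h : Represents k A φ G S) {L : List (List (List ℕ))}
    (hL : isSettled k A L = true) (hn : ¬ Nonplanar G) (hP : ¬ HasInducedP5 G) :
    ∃ rows ∈ L, ∃ φ, Represents k (ofRows rows) φ G S := by
  simp only [isSettled, orElse_eq_true, anyIn_eq_true] at hL
  obtain hL | hL | ⟨rows, hrows, hL⟩ := hL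
  · exact absurd (h.hasInducedP5 hL) hP
  · exact absurd (h.nonplanar hL) hn
  · obtain ⟨l, hl⟩ := exists_isIso_of_findIso hL
    exact ⟨rows, hrows, _, h.comp hl⟩

open scoped Classical in
theorem insert {C : SimpleGraph V} {v : V} (h : Represents k A φ C (S.erase v)) (hv : v ∈ S)
    {nb rem : List ℕ} (hnb : ∀ i < k, G.Adj v (φ i) ↔ i ∈ nb)
    (hrem : ∀ i < k, ∀ j < k, G.Adj (φ i) (φ j) ↔ C.Adj (φ i) (φ j) ∧ ¬ (i ∈ rem ∧ j ∈ rem))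
    (hk : k ∉ nb) :
    Represents (k + 1) (addVertex k A nb rem) (Function.update φ k v) G S := by
  have hlt : ∀ {i}, i < k + 1 → i = k ∨ i ≠ k ∧ i < k := fun hi => by omega
  refine ⟨fun i hi => ?_, fun i hi j hj hij => ?_, fun i hi j hj => ?_⟩
  · rcases hlt hi with rfl | ⟨hne, hi⟩
    · simpa using hv
    · simpa [hne] using Finset.mem_of_mem_erase (h.mem i hi)
  · rcases hlt hi with rfl | ⟨hne, hi⟩ <;> rcases hlt hj with rfl | ⟨hne', hj⟩
    · rfl
    · simp only [Function.update_self, Function.update_of_ne hne'] at hij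
      exact absurd hij.symm (Finset.ne_of_mem_erase (h.mem j hj))
    · simp only [Function.update_self, Function.update_of_ne hne] at hij
      exact absurd hij (Finset.ne_of_mem_erase (h.mem i hi))
    · simp only [Function.update_of_ne hne, Function.update_of_ne hne'] at hij
      exact h.inj i hi j hj hij
  · rcases hlt hi with rfl | ⟨hne, hi⟩ <;> rcases hlt hj with rfl | ⟨hne', hj⟩
    · simp [addVertex_left, hk]
    · simp only [Function.update_self, Function.update_of_ne hne', addVertex_left, hnb j hj]
    · rw [addVertex_right hne, Function.update_self, Function.update_of_ne hne, G.adj_comm,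
        hnb i hi]
    · rw [addVertex_of_ne hne hne', Function.update_of_ne hne, Function.update_of_ne hne',
        hrem i hi j hj, h.adj i hi j hj]

end Represents

/-- Lists of graphs, given by lower adjacency rows, containing all triangulations without induced
`P₅` on at most nine vertices. -/
def catalog : ℕ → List (List (List ℕ))
  | 3 => [[[], [0], [0, 1]]]
  | 4 => [[[], [0], [0, 1], [0, 1, 2]]]
  | 5 => [[[], [0], [0, 1], [0, 1, 2], [0, 1, 2]]]
  | 6 => [[[], [0], [0, 1], [0, 1, 2], [0, 1, 2], [0, 1, 3]],
      [[], [], [0, 1], [0, 1, 2], [0, 1, 2], [0, 1, 3, 4]]]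
  | 7 => [[[], [0], [0, 1], [0, 1, 2], [0, 1, 2], [0, 1, 3], [0, 2, 3]],
      [[], [0], [0, 1], [0, 1, 2], [0, 1, 2], [0, 1, 3], [0, 2, 4]],
      [[], [], [0, 1], [0, 1, 2], [0, 1, 2], [0, 1, 3], [0, 1, 4, 5]],
      [[], [], [0, 1], [0, 1, 2], [0, 1, 2], [0, 1, 3, 4], [0, 2, 3]]]
  | 8 => [[[], [0], [0, 1], [0, 1, 2], [0, 1, 2], [0, 1, 3], [0, 2, 3], [1, 2, 3]],
      [[], [0], [0, 1], [0, 1, 2], [0, 1, 2], [0, 1, 3], [0, 2, 3], [1, 2, 4]],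
      [[], [0], [0, 1], [0, 1, 2], [0, 1, 2], [0, 1, 3], [0, 2, 4], [1, 3, 5]],
      [[], [], [1], [0, 1, 2], [0, 1, 2], [0, 1, 3], [0, 1, 4, 5], [0, 2, 3, 4]],
      [[], [], [0, 1], [0, 1, 2], [0, 1, 2], [0, 1, 3, 4], [0, 2, 3], [1, 4, 5]]]
  | _ => []

theorem isCovered_catalog {k : ℕ} (hk : 3 ≤ k) (hk' : k < 9) :
    isCovered k (catalog k) (catalog (k + 1)) = true := by
  interval_cases k <;> decide +kernel

section Final

open scoped Classical

/-- Every triangulation without induced `P₅` on `k` vertices is isomorphic to a member of `L`. -/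
def IsCompleteList (V : Type*) [Fintype V] (k : ℕ) (L : List (List (List ℕ))) : Prop :=
  ∀ (G : SimpleGraph V) (S : Finset V), S.card = k → IsP5FreeTriangulation G S →
    ∃ rows ∈ L, ∃ φ, Represents k (ofRows rows) φ G S

variable {V : Type*} [Fintype V]

theorem isCompleteList_three : IsCompleteList V 3 (catalog 3) := by
  intro G S hS h
  have hE := h.card_edges
  obtain ⟨x, y, z, hxy, hxz, hyz, rfl⟩ := Finset.card_eq_three.mp hS
  have hsub : G.edgeFinset ⊆ {s(x, y), s(x, z), s(y, z)} := by
    intro e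
    induction e with | _ a b
    simp only [SimpleGraph.mem_edgeFinset, SimpleGraph.mem_edgeSet, Finset.mem_insert,
      Finset.mem_singleton, Sym2.eq_iff]
    intro hab
    have h1 := h.supportedOn a b hab
    have h2 := h.supportedOn b a hab.symm
    have h3 := hab.ne
    simp only [Finset.mem_insert, Finset.mem_singleton] at h1 h2
    grind
  have heq := Finset.eq_of_subset_of_card_le hsub (Finset.card_le_three.trans (by omega))
  have hadj : G.Adj x y ∧ G.Adj x z ∧ G.Adj y z := by
    simp only [← SimpleGraph.mem_edgeSet, ← SimpleGraph.mem_edgeFinset, heq]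
    simp
  refine ⟨[[], [0], [0, 1]], by simp [catalog],
    fun i => if i = 0 then x else if i = 1 then y else z,
    ?_, ?_, ?_⟩
  · intro i _
    split_ifs <;> simp
  · intro i hi j hj
    interval_cases i <;> interval_cases j <;> simp [hxy, hxz, hyz, hxy.symm, hxz.symm, hyz.symm]
  · have hA : ∀ i < 3, ∀ j < 3, ofRows [[], [0], [0, 1]] i j = true ↔ i ≠ j := by decide +kernel
    intro i hi j hj
    rw [hA i hi j hj]
    interval_cases i <;> interval_cases j <;> simp [hadj, hadj.1.symm, hadj.2.1.symm, hadj.2.2.symm]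

theorem IsCompleteList.succ {k : ℕ} {L L' : List (List (List ℕ))} (hL : IsCompleteList V k L)
    (hk : 3 ≤ k) (hk' : k < 11) (hc : isCovered k L L' = true) : IsCompleteList V (k + 1) L' := by
  intro G S hS h
  obtain ⟨v, hv, u, huv, hC, x, y, hxy, hux, huy, hcase⟩ := h.exists_reduction (by omega) (by omega)
  have hcard : (S.erase v).card = k := by
    rw [Finset.card_erase_of_mem hv]
    omega
  obtain ⟨rows, hrows, φ, hφ⟩ := hL _ _ hcard hC
  simp only [isCovered, allIn_eq_true, allBelow_eq_true, orElse_eq_true, andThen_eq_true,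
    notThen_eq_true, and_true, Nat.blt_eq] at hc
  replace hc := hc rows hrows
  have hφv : ∀ i < k, φ i ≠ v := fun i hi => Finset.ne_of_mem_erase (hφ.mem i hi)
  have hidx : ∀ z, G.Adj v z → ∃ i < k, φ i = z := fun z hz =>
    hφ.exists_eq hcard (Finset.mem_erase.mpr ⟨hz.ne.symm, h.supportedOn z v hz.symm⟩)
  have hiff : ∀ i < k, ∀ j < k, φ i = φ j ↔ i = j := fun i hi j hj =>
    ⟨hφ.inj i hi j hj, fun h' => h' ▸ rfl⟩
  have hcadj : ∀ {a b}, a ≠ v → b ≠ v → ((contract G u v).Adj a b ↔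
      a ≠ b ∧ (G.Adj a b ∨ a = u ∧ G.Adj v b ∨ b = u ∧ G.Adj v a)) := by
    intro a b ha hb
    rw [contract_adj]
    tauto
  have hA : ∀ {i j}, i < k → j < k → φ i ≠ φ j →
      (G.Adj (φ i) (φ j) ∨ φ i = u ∧ G.Adj v (φ j) ∨ φ j = u ∧ G.Adj v (φ i)) →
      ofRows rows i j = true := fun hi hj hij hor =>
    (hφ.adj _ hi _ hj).mp ((hcadj (hφv _ hi) (hφv _ hj)).mpr ⟨hij, hor⟩)
  have hfin : ∀ nb rem, (∀ i < k, G.Adj v (φ i) ↔ i ∈ nb) → k ∉ nb →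
      (∀ i < k, ∀ j < k, G.Adj (φ i) (φ j) ↔
        (contract G u v).Adj (φ i) (φ j) ∧ ¬ (i ∈ rem ∧ j ∈ rem)) →
      isSettled (k + 1) (addVertex k (ofRows rows) nb rem) L' = true →
      ∃ rows ∈ L', ∃ φ, Represents (k + 1) (ofRows rows) φ G S :=
    fun nb rem hnb hk hrem hs => (hφ.insert hv hnb hrem hk).exists_of_isSettled hs
      h.not_nonplanar h.not_hasInducedP5
  rcases hcase with ⟨hadj, hN⟩ | ⟨b, hub, hnub, hbx, hby, hN⟩
  · obtain ⟨iu, hiu, rfl⟩ := hidx u ((hN u).mpr (by simp))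
    obtain ⟨ix, hix, rfl⟩ := hidx x ((hN x).mpr (by simp))
    obtain ⟨iy, hiy, rfl⟩ := hidx y ((hN y).mpr (by simp))
    have a1 := hA hiu hix hux.ne (Or.inl hux)
    have a2 := hA hiu hiy huy.ne (Or.inl huy)
    have a3 := hA hix hiy hxy (Or.inl hadj)
    have a4 := hA hix hiu hux.ne.symm (Or.inl hux.symm)
    have a5 := hA hiy hiu huy.ne.symm (Or.inl huy.symm)
    have a6 := hA hiy hix hxy.symm (Or.inl hadj.symm)
    have hsort : ∃ i < k, ∃ j < i, ∃ p < j, ofRows rows i j = true ∧ ofRows rows i p = true ∧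
        ofRows rows j p = true ∧ ∀ m, m ∈ [i, j, p] ↔ m = iu ∨ m = ix ∨ m = iy := by
      have n1 : iu ≠ ix := fun h' => hux.ne (h' ▸ rfl)
      have n2 : iu ≠ iy := fun h' => huy.ne (h' ▸ rfl)
      have n3 : ix ≠ iy := fun h' => hxy (h' ▸ rfl)
      simp only [List.mem_cons, List.not_mem_nil, or_false]
      rcases n1.lt_or_gt with l1 | l1 <;> rcases n2.lt_or_gt with l2 | l2 <;>
        rcases n3.lt_or_gt with l3 | l3 <;> first
        | omega
        | exact ⟨iu, ‹_›, ix, ‹_›, iy, ‹_›, ‹_›, ‹_›, ‹_›, fun m => by tauto⟩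
        | exact ⟨iu, ‹_›, iy, ‹_›, ix, ‹_›, ‹_›, ‹_›, ‹_›, fun m => by tauto⟩
        | exact ⟨ix, ‹_›, iu, ‹_›, iy, ‹_›, ‹_›, ‹_›, ‹_›, fun m => by tauto⟩
        | exact ⟨ix, ‹_›, iy, ‹_›, iu, ‹_›, ‹_›, ‹_›, ‹_›, fun m => by tauto⟩
        | exact ⟨iy, ‹_›, iu, ‹_›, ix, ‹_›, ‹_›, ‹_›, ‹_›, fun m => by tauto⟩
        | exact ⟨iy, ‹_›, ix, ‹_›, iu, ‹_›, ‹_›, ‹_›, ‹_›, fun m => by tauto⟩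
    obtain ⟨i, hi, j, hj, p, hp, b1, b2, b3, hm⟩ := hsort
    refine hfin [i, j, p] [] (fun m hm' => ?_) ?_ (fun m hm' m' hm'' => ?_) ?_
    · rw [hN, hm, hiff _ hm' _ hiu, hiff _ hm' _ hix, hiff _ hm' _ hiy]
    · rw [hm]
      omega
    · rw [hcadj (hφv _ hm') (hφv _ hm'')]
      simp only [List.not_mem_nil, false_and, not_false_eq_true, and_true]
      refine ⟨fun h' => ⟨h'.ne, Or.inl h'⟩, ?_⟩
      rintro ⟨hne, h' | ⟨e, h'⟩ | ⟨e, h'⟩⟩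
      · exact h'
      · rw [e] at hne ⊢
        rcases (hN _).mp h' with h' | h' | h'
        exacts [absurd h'.symm hne, h' ▸ hux, h' ▸ huy]
      · rw [e] at hne ⊢
        rcases (hN _).mp h' with h' | h' | h'
        exacts [absurd h' hne, h' ▸ hux.symm, h' ▸ huy.symm]
    · have hpk := hp.trans (hj.trans hi)
      exact (((hc i hi j hj).resolve_left (· b1) p hpk).resolve_left (· ⟨b2, b3⟩)).1.resolve_left
        (· hp)
  · obtain ⟨iu, hiu, rfl⟩ := hidx u ((hN u).mpr (by simp))
    obtain ⟨ib, hib, rfl⟩ := hidx b ((hN b).mpr (by simp))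
    obtain ⟨ix, hix, rfl⟩ := hidx x ((hN x).mpr (by simp))
    obtain ⟨iy, hiy, rfl⟩ := hidx y ((hN y).mpr (by simp))
    have hvb := (hN (φ ib)).mpr (by simp)
    have hij : ∃ i < k, ∃ j < i, ofRows rows i j = true ∧ ∀ m, m ∈ [i, j] ↔ m = iu ∨ m = ib := by
      have a1 := hA hiu hib hub (Or.inr (Or.inl ⟨rfl, hvb⟩))
      have a2 := hA hib hiu hub.symm (Or.inr (Or.inr ⟨rfl, hvb⟩))
      have hne : iu ≠ ib := fun h' => hub (h' ▸ rfl)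
      rcases hne.lt_or_gt with hlt | hlt
      · exact ⟨ib, hib, iu, hlt, a2, fun m => by simp [or_comm]⟩
      · exact ⟨iu, hiu, ib, hlt, a1, fun m => by simp⟩
    have hpq : ∃ p < k, ∃ q < p, ∀ m, m ∈ [p, q] ↔ m = ix ∨ m = iy := by
      have hne : ix ≠ iy := fun h' => hxy (h' ▸ rfl)
      rcases hne.lt_or_gt with hlt | hlt
      · exact ⟨iy, hiy, ix, hlt, fun m => by simp [or_comm]⟩
      · exact ⟨ix, hix, iy, hlt, fun m => by simp⟩
    obtain ⟨i, hi, j, hj, hAij, hij⟩ := hij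
    obtain ⟨p, hp, q, hq, hpq⟩ := hpq
    have hcross : ∀ m ∈ [i, j], ∀ m' ∈ [p, q], ofRows rows m m' = true := by
      intro m hm m' hm'
      rcases (hij m).mp hm with rfl | rfl <;> rcases (hpq m').mp hm' with rfl | rfl
      exacts [hA hiu hix hux.ne (Or.inl hux), hA hiu hiy huy.ne (Or.inl huy),
        hA hib hix hbx.ne (Or.inl hbx), hA hib hiy hby.ne (Or.inl hby)]
    have hmem : ∀ m, m ∈ [i, j, p, q] ↔ m = iu ∨ m = ib ∨ m = ix ∨ m = iy := fun m => by
      rw [← or_assoc, ← hij, ← hpq]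
      simp [or_assoc]
    refine hfin [i, j, p, q] [i, j] (fun m hm => ?_) ?_ (fun m hm m' hm' => ?_) ?_
    · rw [hN, hmem, hiff _ hm _ hiu, hiff _ hm _ hib, hiff _ hm _ hix, hiff _ hm _ hiy]
    · rw [hmem]
      omega
    · rw [hcadj (hφv _ hm) (hφv _ hm'), hij, hij, ← hiff _ hm _ hiu, ← hiff _ hm _ hib,
        ← hiff _ hm' _ hiu, ← hiff _ hm' _ hib]
      refine ⟨fun h' => ⟨⟨h'.ne, Or.inl h'⟩, ?_⟩, ?_⟩
      · rintro ⟨e | e, e' | e'⟩ <;> rw [e, e'] at h'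
        exacts [h'.ne rfl, hnub h', hnub h'.symm, h'.ne rfl]
      · rintro ⟨⟨hne, h' | ⟨e, h'⟩ | ⟨e, h'⟩⟩, hnot⟩
        · exact h'
        · rw [e] at hne hnot ⊢
          rcases (hN _).mp h' with h' | h' | h' | h'
          exacts [absurd h'.symm hne, absurd ⟨Or.inl rfl, Or.inr h'⟩ hnot, h' ▸ hux, h' ▸ huy]
        · rw [e] at hne hnot ⊢
          rcases (hN _).mp h' with h' | h' | h' | h'
          exacts [absurd h' hne, absurd ⟨Or.inr h', Or.inl rfl⟩ hnot, h' ▸ hux.symm,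
            h' ▸ huy.symm]
    · exact (((hc i hi j hj).resolve_left (· hAij) p hp).resolve_left
        (· ⟨hcross i (by simp) p (by simp), hcross j (by simp) p (by simp)⟩)).2 q hq |>.resolve_left
        (· ⟨hcross i (by simp) q (by simp), hcross j (by simp) q (by simp)⟩)

theorem isCompleteList_catalog {k : ℕ} (hk : 3 ≤ k) (hk' : k ≤ 9) :
    IsCompleteList V k (catalog k) := by
  induction k, hk using Nat.le_induction with
  | base => exact isCompleteList_three
  | succ k hk ih => exact (ih (by omega)).succ hk (by omega) (isCovered_catalog hk (by omega))

theorem not_isP5FreeTriangulation (k : ℕ) (hk : 9 ≤ k) (G : SimpleGraph V) (S : Finset V)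
    (hS : S.card = k) : ¬ IsP5FreeTriangulation G S := by
  induction k, hk using Nat.le_induction generalizing G S with
  | base =>
    intro h
    obtain ⟨rows, hrows, -⟩ := isCompleteList_catalog (by norm_num) le_rfl G S hS h
    simp [catalog] at hrows
  | succ k hk ih =>
    intro h
    have hE := h.card_edges
    obtain ⟨v, hv, hd⟩ := h.supportedOn.exists_degree_le (d := 5) (by omega)
    obtain ⟨u, -, -, hC⟩ := h.exists_contract (by omega) hv hd
    refine ih _ _ ?_ hC
    rw [Finset.card_erase_of_mem hv]
    omega

end Final

theorem stmt_14 (n : ℕ) (hn : 9 ≤ n) (G : SimpleGraph (Fin n))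
    (hP : IsPlanar G) (hE : G.edgeSet.ncard = 3 * n - 6) :
    ContainsInduced (pathGraph 5) G := by
  classical
  by_contra hG
  refine not_isP5FreeTriangulation n hn G Finset.univ (by simp)
    ⟨fun a _ _ => Finset.mem_univ a, hP.not_nonplanar, ?_, fun h => hG h.containsInduced⟩
  rw [← SimpleGraph.coe_edgeFinset, Set.ncard_coe_finset] at hE
  rw [Finset.card_univ, Fintype.card_fin]
  convert (show G.edgeFinset.card + 6 = 3 * n by omega)
end

section
/- Let G be a 3-connected planar graph containing no induced copy of P_5, and let X = {x₁, x₂, x₃} be a vertex set of G such that deleting X disconnects G. Let G' be the graph obtained from G by adding all the edges among x₁, x₂, x₃ that are not already present. Then G' is planar and contains no induced copy of P_5. -/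
open SimpleGraph

/-- A graph is 3-connected if it has at least 4 vertices and deleting any set of at most
two vertices leaves it connected. -/
def ThreeConnected {V : Type*} [Fintype V] (G : SimpleGraph V) : Prop :=
  4 ≤ Fintype.card V ∧ ∀ s : Set V, s.ncard ≤ 2 → (G.induce sᶜ).Connected

/-- `u` and `v` are joined by a walk of `G` that stays inside `S`. -/
def WalkJoined {V : Type*} (G : SimpleGraph V) (S : Set V) (u v : V) : Prop :=
  ∃ p : G.Walk u v, ∀ x ∈ p.support, x ∈ S

/-- Any two vertices of `S` are joined by a walk of `G` inside `S`. -/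
def ConnOn {V : Type*} (G : SimpleGraph V) (S : Set V) : Prop :=
  ∀ u ∈ S, ∀ v ∈ S, WalkJoined G S u v

/-- `G` has a minor model of `H`: pairwise disjoint connected branch sets indexed by the vertices
of `H`, with an edge of `G` between the branch sets of adjacent vertices of `H`. -/
structure IsModel {W V : Type*} (H : SimpleGraph W) (G : SimpleGraph V) (M : W → Set V) :
    Prop where
  conn : ∀ w, ConnOn G (M w)
  disj : ∀ v w x, x ∈ M v → x ∈ M w → v = w
  adj : ∀ v w, H.Adj v w → ∃ x ∈ M v, ∃ y ∈ M w, G.Adj x y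

/-- A system of paths inside `S` from a common centre to the terminals `t i`,
pairwise meeting only in the centre. -/
def HasSpider {V ι : Type*} (G : SimpleGraph V) (S : Set V) (t : ι → V) : Prop :=
  ∃ (c : V) (P : ∀ i, G.Walk c (t i)), c ∈ S ∧ (∀ i, (P i).IsPath) ∧
    (∀ i, ∀ x ∈ (P i).support, x ∈ S) ∧
    ∀ i j, i ≠ j → ∀ x ∈ (P i).support, x ∈ (P j).support → x = c

section Joined

variable {V : Type*} {G : SimpleGraph V} {S T : Set V} {u v w : V}

theorem WalkJoined.refl (h : u ∈ S) : WalkJoined G S u u := ⟨.nil, by simpa using h⟩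

theorem WalkJoined.symm (h : WalkJoined G S u v) : WalkJoined G S v u := by
  obtain ⟨p, hp⟩ := h
  exact ⟨p.reverse, by simpa using hp⟩

theorem WalkJoined.trans (h : WalkJoined G S u v) (h' : WalkJoined G S v w) : WalkJoined G S u w := by
  obtain ⟨p, hp⟩ := h
  obtain ⟨q, hq⟩ := h'
  refine ⟨p.append q, fun x hx ↦ ?_⟩
  rw [Walk.mem_support_append_iff] at hx
  exact hx.elim (hp x) (hq x)

theorem WalkJoined.mono (hST : S ⊆ T) (h : WalkJoined G S u v) : WalkJoined G T u v := by
  obtain ⟨p, hp⟩ := h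
  exact ⟨p, fun x hx ↦ hST (hp x hx)⟩

theorem WalkJoined.of_adj (h : G.Adj u v) (hu : u ∈ S) (hv : v ∈ S) : WalkJoined G S u v :=
  ⟨h.toWalk, by simp [hu, hv]⟩

theorem WalkJoined.left_mem (h : WalkJoined G S u v) : u ∈ S := h.choose_spec _ (by simp)

theorem WalkJoined.right_mem (h : WalkJoined G S u v) : v ∈ S := h.choose_spec _ (by simp)

/-- A walk all of whose steps can be replaced by connections in another graph. -/
theorem WalkJoined.lift {G' : SimpleGraph V} (h : WalkJoined G' S u v) (hST : S ⊆ T)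
    (hstep : ∀ x ∈ S, ∀ y ∈ S, G'.Adj x y → WalkJoined G T x y) : WalkJoined G T u v := by
  obtain ⟨p, hp⟩ := h
  induction p with
  | nil => exact .refl (hST (hp _ (by simp)))
  | cons h p ih =>
    simp only [Walk.support_cons, List.mem_cons, forall_eq_or_imp] at hp
    exact (hstep _ hp.1 _ (hp.2 _ (by simp)) h).trans (ih hp.2)

theorem ConnOn.of_center (c : V) (h : ∀ u ∈ S, WalkJoined G S u c) : ConnOn G S :=
  fun u hu v hv ↦ (h u hu).trans (h v hv).symm

theorem walkJoined_of_mem_support {a b : V} (p : G.Walk a b) (hu : u ∈ p.support)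
    (hp : ∀ x ∈ p.support, x ∈ S) : WalkJoined G S a u := by
  classical
  exact ⟨p.takeUntil u hu, fun x hx ↦ hp x (p.support_takeUntil_subset_support hu hx)⟩

theorem WalkJoined.exists_path (h : WalkJoined G S u v) :
    ∃ p : G.Walk u v, p.IsPath ∧ ∀ x ∈ p.support, x ∈ S := by
  classical
  obtain ⟨p, hp⟩ := h
  exact ⟨p.bypass, p.bypass_isPath, fun x hx ↦ hp x (p.support_bypass_subset_support hx)⟩

/-- The initial part of a walk up to its first vertex in `T`, made into a path. -/
theorem WalkJoined.exists_path_first_hit (h : WalkJoined G S u v) (hv : v ∈ T) :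
    ∃ z ∈ T, ∃ q : G.Walk u z, q.IsPath ∧ (∀ x ∈ q.support, x ∈ S) ∧
      ∀ x ∈ q.support, x ∈ T → x = z := by
  classical
  obtain ⟨p, hp⟩ := h
  suffices H : ∃ z ∈ T, ∃ q : G.Walk u z, (∀ x ∈ q.support, x ∈ S) ∧
      ∀ x ∈ q.support, x ∈ T → x = z by
    obtain ⟨z, hz, q, h₁, h₂⟩ := H
    exact ⟨z, hz, q.bypass, q.bypass_isPath, fun x hx ↦ h₁ x (q.support_bypass_subset_support hx),
      fun x hx ↦ h₂ x (q.support_bypass_subset_support hx)⟩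
  induction p with
  | nil => exact ⟨_, hv, .nil, hp, by simp⟩
  | @cons a b c h p ih =>
    by_cases ha : a ∈ T
    · exact ⟨a, ha, .nil, by simpa using hp a (by simp), by simp⟩
    · obtain ⟨z, hz, q, h₁, h₂⟩ := ih hv fun x hx ↦ hp x (by simp [hx])
      refine ⟨z, hz, .cons h q, ?_, ?_⟩
      · simpa using ⟨hp a (by simp), h₁⟩
      · simpa [ha] using h₂

theorem SimpleGraph.Walk.IsPath.exists_split {a b z : V} {p : G.Walk a b} (hp : p.IsPath)
    (hz : z ∈ p.support) : ∃ (r : G.Walk a z) (s : G.Walk z b), r.IsPath ∧ s.IsPath ∧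
      r.support ⊆ p.support ∧ s.support ⊆ p.support ∧
      ∀ x ∈ r.support, x ∈ s.support → x = z := by
  induction p with
  | nil =>
    obtain rfl : z = _ := by simpa using hz
    exact ⟨.nil, .nil, by simp⟩
  | @cons a b c h p ih =>
    rw [Walk.cons_isPath_iff] at hp
    by_cases ha : z = a
    · subst ha
      exact ⟨.nil, .cons h p, by simp [hp]⟩
    · obtain ⟨r, s, hr, hs, hrp, hsp, hrs⟩ := ih hp.1 (by simpa [ha] using hz)
      refine ⟨.cons h r, s, ?_, hs, ?_, ?_, ?_⟩
      · rw [Walk.cons_isPath_iff]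
        exact ⟨hr, fun h' ↦ hp.2 (hrp h')⟩
      · exact List.cons_subset_cons a hrp
      · exact List.subset_cons_of_subset a hsp
      · intro x hx hxs
        rw [Walk.support_cons, List.mem_cons] at hx
        rcases hx with rfl | hx
        · exact absurd (hsp hxs) hp.2
        · exact hrs x hx hxs

/-- Cutting a path just before an inner or final vertex `z`. -/
theorem SimpleGraph.Walk.IsPath.exists_cut {a b z : V} {p : G.Walk a b} (hp : p.IsPath)
    (hz : z ∈ p.support) (hza : z ≠ a) :
    ∃ (y : V) (r : G.Walk a y) (s : G.Walk z b), G.Adj y z ∧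
      r.support ⊆ p.support ∧ s.support ⊆ p.support ∧ ∀ x ∈ r.support, x ∉ s.support := by
  induction p with
  | nil => exact absurd (by simpa using hz) hza
  | @cons a b c h p ih =>
    rw [Walk.cons_isPath_iff] at hp
    by_cases hb : z = b
    · subst hb
      exact ⟨a, .nil, p, h, by simp, by simp, by simpa using hp.2⟩
    · obtain ⟨y, r, s, hyz, hrp, hsp, hrs⟩ := ih hp.1 (by simpa [hza] using hz) hb
      refine ⟨y, .cons h r, s, hyz, ?_, ?_, ?_⟩
      · exact List.cons_subset_cons a hrp
      · exact List.subset_cons_of_subset a hsp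
      · simpa using ⟨fun h' ↦ hp.2 (hsp h'), hrs⟩

end Joined

section Models

variable {W V : Type*} {H : SimpleGraph W} {G : SimpleGraph V}

theorem ContainsSubdivision.exists_isModel [Countable W]
    (h : ContainsSubdivision H G) : ∃ M : W → Set V, IsModel H G M := by
  classical
  obtain ⟨e, he⟩ := Countable.exists_injective_nat W
  obtain ⟨f, p, hpath, hbranch, hdisj⟩ := h
  let M : W → Set V := fun a ↦ {x | x = f a ∨
    ∃ b, ∃ h : H.Adj a b, e a < e b ∧ x ∈ (p h).support ∧ x ≠ f b}
  have hadj : ∀ a b, H.Adj a b → e a < e b → ∃ x ∈ M a, ∃ y ∈ M b, G.Adj x y := by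
    intro a b h hlt
    have hne : f a ≠ f b := f.injective.ne h.ne
    have hnil : ¬ (p h).Nil := fun h' ↦ hne h'.eq
    have had := (p h).adj_penultimate hnil
    exact ⟨_, .inr ⟨b, h, hlt, (p h).getVert_mem_support _, had.ne⟩, f b, .inl rfl, had⟩
  refine ⟨M, fun a ↦ .of_center (f a) ?_, ?_, ?_⟩
  · rintro x (rfl | ⟨b, h, hlt, hx, hxb⟩)
    · exact .refl (.inl rfl)
    · refine WalkJoined.symm ⟨(p h).takeUntil x hx, fun y hy ↦ .inr ⟨b, h, hlt,
        (p h).support_takeUntil_subset_support hx hy, ?_⟩⟩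
      rintro rfl
      exact Walk.endpoint_notMem_support_takeUntil (hpath h) hx hxb.symm hy
  · rintro a c x (rfl | ⟨b, h, hlt, hx, hxb⟩) (hc | ⟨d, h', hlt', hx', hxd⟩)
    · exact f.injective hc
    · rcases hbranch h' a hx' with rfl | rfl
      · rfl
      · exact absurd rfl hxd
    · subst hc
      rcases hbranch h c hx with rfl | rfl
      · rfl
      · exact absurd rfl hxb
    · by_cases hs : s(a, b) = s(c, d)
      · rcases Sym2.eq_iff.1 hs with ⟨rfl, -⟩ | ⟨rfl, rfl⟩
        · rfl
        · omega
      · obtain ⟨h₁, h₂⟩ := hdisj h h' hs x hx hx'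
        exact f.injective ((h₁.resolve_right hxb).symm.trans (h₂.resolve_right hxd))
  · intro a b h
    rcases lt_or_gt_of_ne (he.ne h.ne) with hlt | hlt
    · exact hadj a b h hlt
    · obtain ⟨x, hx, y, hy, hxy⟩ := hadj b a h.symm hlt
      exact ⟨y, hy, x, hx, hxy.symm⟩

theorem IsModel.exists_terminals [Countable W] [Nonempty V] {M : W → Set V}
    (hM : IsModel H G M) :
    ∃ t : W → W → V, ∀ a b, H.Adj a b → t a b ∈ M a ∧ G.Adj (t a b) (t b a) := by
  obtain ⟨e, he⟩ := Countable.exists_injective_nat W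
  have h : ∀ a b, H.Adj a b → ∃ q : V × V, q.1 ∈ M a ∧ q.2 ∈ M b ∧ G.Adj q.1 q.2 := by
    intro a b hab
    obtain ⟨x, hx, y, hy, hxy⟩ := hM.adj a b hab
    exact ⟨(x, y), hx, hy, hxy⟩
  choose! q hq using h
  refine ⟨fun a b ↦ if e a < e b then (q a b).1 else (q b a).2, fun a b hab ↦ ?_⟩
  rcases lt_or_gt_of_ne (he.ne hab.ne) with hlt | hlt
  · simp only [hlt, hlt.not_gt, if_true, if_false]
    exact ⟨(hq a b hab).1, (hq a b hab).2.2⟩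
  · simp only [hlt, hlt.not_gt, if_true, if_false]
    exact ⟨(hq b a hab.symm).2.1, (hq b a hab.symm).2.2.symm⟩

/-- If in each branch set the terminals of the incident edges are the feet of a spider,
then the spiders combine to a subdivision. -/
theorem IsModel.containsSubdivision {M : W → Set V} (hM : IsModel H G M) {t : W → W → V}
    (ht : ∀ a b, H.Adj a b → G.Adj (t a b) (t b a))
    (hs : ∀ a, HasSpider G (M a) fun b : H.neighborSet a ↦ t a b) :
    ContainsSubdivision H G := by
  choose c P hc hP hPM hPP using hs
  have hpath : ∀ a b (h : H.Adj a b), ∃ p : G.Walk (c a) (c b), p.IsPath ∧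
      ∀ x ∈ p.support, x ∈ (P a ⟨b, h⟩).support ∨ x ∈ (P b ⟨a, h.symm⟩).support := by
    intro a b h
    refine WalkJoined.exists_path
      (S := {x | x ∈ (P a ⟨b, h⟩).support ∨ x ∈ (P b ⟨a, h.symm⟩).support}) ?_
    refine WalkJoined.trans ⟨P a ⟨b, h⟩, fun x hx ↦ .inl hx⟩ ?_
    refine WalkJoined.trans (.of_adj (ht a b h) (.inl (by simp)) (.inr (by simp))) ?_
    exact WalkJoined.symm ⟨P b ⟨a, h.symm⟩, fun x hx ↦ .inr hx⟩
  choose p hp hpP using hpath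
  have hloc : ∀ a b (h : H.Adj a b) x, x ∈ (p a b h).support →
      ∃ a' b', ∃ h' : H.Adj a' b', s(a', b') = s(a, b) ∧ x ∈ (P a' ⟨b', h'⟩).support := by
    intro a b h x hx
    rcases hpP a b h x hx with hx | hx
    · exact ⟨a, b, h, rfl, hx⟩
    · exact ⟨b, a, h.symm, Sym2.eq_swap, hx⟩
  refine ⟨⟨c, fun a b hab ↦ hM.disj a b _ (hc a) (hab ▸ hc b)⟩, fun a b h ↦ p a b h,
    hp, ?_, ?_⟩
  · intro a b h w hw
    obtain ⟨a', b', h', hs, hx⟩ := hloc a b h _ hw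
    obtain rfl : w = a' := hM.disj _ _ _ (hc w) (hPM _ _ _ hx)
    have : w ∈ s(a, b) := hs ▸ Sym2.mem_mk_left _ _
    simpa using this
  · intro a b a₂ b₂ h h₂ hne x hx hx₂
    obtain ⟨a', b', h', hs, hx⟩ := hloc a b h _ hx
    obtain ⟨a₂', b₂', h₂', hs₂, hx₂⟩ := hloc a₂ b₂ h₂ _ hx₂
    obtain rfl : a' = a₂' := hM.disj _ _ _ (hPM _ _ _ hx) (hPM _ _ _ hx₂)
    have hbb : b' ≠ b₂' := by
      rintro rfl
      exact hne (hs.symm.trans hs₂)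
    obtain rfl := hPP a' _ _ (fun h ↦ hbb (congrArg Subtype.val h)) x hx hx₂
    have h₁ : a' ∈ s(a, b) := hs ▸ Sym2.mem_mk_left _ _
    have h₂ : a' ∈ s(a₂, b₂) := hs₂ ▸ Sym2.mem_mk_left _ _
    rw [Sym2.mem_iff] at h₁ h₂
    exact ⟨h₁.imp (congrArg c) (congrArg c), h₂.imp (congrArg c) (congrArg c)⟩

end Models

section Spiders

variable {V : Type*} {G : SimpleGraph V} {S : Set V}

theorem HasSpider.comp {ι κ : Type*} {t : ι → V} (h : HasSpider G S t) (e : κ ↪ ι) :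
    HasSpider G S (t ∘ e) := by
  obtain ⟨c, P, hc, hP, hPS, hPP⟩ := h
  exact ⟨c, fun i ↦ P (e i), hc, fun i ↦ hP _, fun i ↦ hPS _,
    fun i j hij ↦ hPP _ _ (e.injective.ne hij)⟩

theorem ConnOn.hasSpider_fin_three (hS : ConnOn G S) (t : Fin 3 → V) (ht : ∀ i, t i ∈ S) :
    HasSpider G S t := by
  obtain ⟨p, hp, hpS⟩ := (hS _ (ht 0) _ (ht 1)).exists_path
  obtain ⟨c, hc, q, hq, hqS, hqp⟩ := (hS _ (ht 2) _ (ht 0)).exists_path_first_hit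
    (T := {x | x ∈ p.support}) (by simp)
  obtain ⟨r, s, hr, hs, hrp, hsp, hrs⟩ := hp.exists_split hc
  refine ⟨c, fun i ↦ match i with
    | 0 => r.reverse
    | 1 => s
    | 2 => q.reverse, hpS c hc, ?_, ?_, ?_⟩
  · intro i
    fin_cases i
    · exact hr.reverse
    · exact hs
    · exact hq.reverse
  · intro i x
    fin_cases i
    · simpa using fun hx ↦ hpS x (hrp hx)
    · simpa using fun hx ↦ hpS x (hsp hx)
    · simpa using hqS x
  · have h₁ : ∀ x ∈ q.support, x ∈ r.support → x = c := fun x hx hx' ↦ hqp x hx (hrp hx')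
    have h₂ : ∀ x ∈ q.support, x ∈ s.support → x = c := fun x hx hx' ↦ hqp x hx (hsp hx')
    intro i j hij x
    fin_cases i <;> fin_cases j <;> simp at hij ⊢ <;> grind

/-- Four terminals in a connected set either are the feet of a spider, or the set contains two
disjoint adjacent connected subsets with two terminals each. -/
theorem ConnOn.hasSpider_fin_four_or_split (hS : ConnOn G S) (t : Fin 4 → V)
    (ht : ∀ i, t i ∈ S) : HasSpider G S t ∨
      ∃ (B₁ B₂ : Set V) (i j : Fin 4), i ≠ j ∧ B₁ ⊆ S ∧ B₂ ⊆ S ∧ ConnOn G B₁ ∧ ConnOn G B₂ ∧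
        (∀ x ∈ B₁, x ∉ B₂) ∧ (∃ x ∈ B₁, ∃ y ∈ B₂, G.Adj x y) ∧ t i ∈ B₁ ∧ t j ∈ B₁ ∧
        ∀ k, k ≠ i → k ≠ j → t k ∈ B₂ := by
  obtain ⟨c, P, hc, hP, hPS, hPP⟩ := hS.hasSpider_fin_three (t ∘ Fin.castSucc) fun i ↦ ht _
  obtain ⟨z, ⟨i, hi⟩, q, hq, hqS, hqP⟩ := (hS _ (ht 3) _ hc).exists_path_first_hit
    (T := {x | ∃ i, x ∈ (P i).support}) ⟨0, by simp⟩
  by_cases hzc : z = c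
  · subst hzc
    left
    refine ⟨z, fun k ↦ match k with
      | 0 => P 0
      | 1 => P 1
      | 2 => P 2
      | 3 => q.reverse, hc, ?_, ?_, ?_⟩
    · intro k
      fin_cases k
      exacts [hP 0, hP 1, hP 2, hq.reverse]
    · intro k x
      fin_cases k
      · exact hPS 0 x
      · exact hPS 1 x
      · exact hPS 2 x
      · simpa using hqS x
    · intro k l hkl x
      have h := fun i j hij ↦ hPP i j hij x
      have h' : ∀ i, x ∈ q.support → x ∈ (P i).support → x = z := fun i hx hx' ↦ hqP x hx ⟨i, hx'⟩
      fin_cases k <;> fin_cases l <;> simp at hkl ⊢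
      any_goals exact h _ _ (by decide)
      any_goals exact h' _
      all_goals exact fun h₁ h₂ ↦ h' _ h₂ h₁
  · right
    obtain ⟨y, r, s, hyz, hrP, hsP, hrs⟩ := (hP i).exists_cut hi hzc
    have hcs : c ∉ s.support := hrs c (by simp)
    refine ⟨{x | x ∈ s.support ∨ x ∈ q.support},
      {x | x ∈ r.support ∨ ∃ j, j ≠ i ∧ x ∈ (P j).support}, i.castSucc, 3, ?_, ?_, ?_, ?_, ?_, ?_,
      ⟨z, .inl (by simp), y, .inl (by simp), hyz.symm⟩, .inl (by simp), .inr (by simp), ?_⟩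
    · exact (Fin.castSucc_lt_last i).ne
    · rintro x (hx | hx)
      exacts [hPS i x (hsP hx), hqS x hx]
    · rintro x (hx | ⟨j, -, hx⟩)
      exacts [hPS i x (hrP hx), hPS j x hx]
    · refine .of_center z ?_
      rintro x (hx | hx)
      · exact (walkJoined_of_mem_support s hx fun x hx ↦ .inl hx).symm
      · refine WalkJoined.symm (walkJoined_of_mem_support q.reverse (by simpa using hx) ?_)
        simpa using fun x hx ↦ .inr hx
    · refine .of_center c ?_
      rintro x (hx | ⟨j, hj, hx⟩)
      · exact (walkJoined_of_mem_support r hx fun x hx ↦ .inl hx).symm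
      · exact (walkJoined_of_mem_support (P j) hx fun x hx ↦ .inr ⟨j, hj, hx⟩).symm
    · rintro x hx hx'
      have hzr : z ∉ r.support := fun h ↦ hrs z h (by simp)
      have hzP : ∀ j, j ≠ i → z ∉ (P j).support := fun j hj h ↦ hzc (hPP j i hj z h hi)
      rcases hx with hx | hx
      · rcases hx' with hx' | ⟨j, hj, hx'⟩
        · exact hrs x hx' hx
        · exact hcs (hPP j i hj x hx' (hsP hx) ▸ hx)
      · rcases hx' with hx' | ⟨j, hj, hx'⟩
        · exact hzr (hqP x hx ⟨i, hrP hx'⟩ ▸ hx')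
        · exact hzP j hj (hqP x hx ⟨j, hx'⟩ ▸ hx')
    · intro k hki hk
      obtain ⟨j, rfl⟩ := Fin.exists_castSucc_eq.2 hk
      exact .inr ⟨j, by rintro rfl; exact hki rfl, (P j).end_mem_support⟩

end Spiders

section Kuratowski

variable {V : Type*} {G : SimpleGraph V}

theorem isModel_completeBipartiteGraph {ι κ : Type*} {A : ι → Set V} {B : κ → Set V}
    (hA : ∀ i, ConnOn G (A i)) (hB : ∀ j, ConnOn G (B j))
    (hAA : ∀ i j x, x ∈ A i → x ∈ A j → i = j) (hBB : ∀ i j x, x ∈ B i → x ∈ B j → i = j)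
    (hAB : ∀ i j x, x ∈ A i → x ∉ B j) (hadj : ∀ i j, ∃ x ∈ A i, ∃ y ∈ B j, G.Adj x y) :
    IsModel (completeBipartiteGraph ι κ) G (Sum.elim A B) where
  conn := by
    rintro (i | j)
    exacts [hA i, hB j]
  disj := by
    rintro (i | i) (j | j) x hi hj
    · exact congrArg _ (hAA i j x hi hj)
    · exact absurd hj (hAB i j x hi)
    · exact absurd hi (hAB j i x hj)
    · exact congrArg _ (hBB i j x hi hj)
  adj := by
    rintro (i | i) (j | j) h
    · simp at h
    · exact hadj i j
    · obtain ⟨x, hx, y, hy, hxy⟩ := hadj j i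
      exact ⟨y, hy, x, hx, hxy.symm⟩
    · simp at h

theorem IsModel.containsSubdivision_completeBipartiteGraph [Nonempty V]
    {M : Fin 3 ⊕ Fin 3 → Set V} (hM : IsModel (completeBipartiteGraph (Fin 3) (Fin 3)) G M) :
    ContainsSubdivision (completeBipartiteGraph (Fin 3) (Fin 3)) G := by
  obtain ⟨t, ht⟩ := hM.exists_terminals
  refine hM.containsSubdivision (fun a b h ↦ (ht a b h).2) ?_
  rintro (i | i)
  · let e : (completeBipartiteGraph (Fin 3) (Fin 3)).neighborSet (.inl i) ↪ Fin 3 :=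
      ⟨fun b ↦ Sum.elim id id b.1, by
        rintro ⟨j | j, hj⟩ ⟨k | k, hk⟩ h <;>
          first | (simp at hj; done) | (simp at hk; done) | simpa using h⟩
    convert ((hM.conn (.inl i)).hasSpider_fin_three (fun j ↦ t (.inl i) (.inr j))
      fun j ↦ (ht _ _ (by simp)).1).comp e using 1
    funext ⟨j, hj⟩
    rcases j with j | j
    · simp at hj
    · rfl
  · let e : (completeBipartiteGraph (Fin 3) (Fin 3)).neighborSet (.inr i) ↪ Fin 3 :=
      ⟨fun b ↦ Sum.elim id id b.1, by
        rintro ⟨j | j, hj⟩ ⟨k | k, hk⟩ h <;>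
          first | (simp at hj; done) | (simp at hk; done) | simpa using h⟩
    convert ((hM.conn (.inr i)).hasSpider_fin_three (fun j ↦ t (.inr i) (.inl j))
      fun j ↦ (ht _ _ (by simp)).1).comp e using 1
    funext ⟨j, hj⟩
    rcases j with j | j
    · rfl
    · simp at hj

theorem IsModel.not_isPlanar_of_completeGraph [Nonempty V] {M : Fin 5 → Set V}
    (hM : IsModel (completeGraph (Fin 5)) G M) : ¬ IsPlanar G := by
  obtain ⟨t, ht⟩ := hM.exists_terminals
  by_cases hs : ∀ a, HasSpider G (M a) fun k ↦ t a (a.succAbove k)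
  · refine fun hP ↦ hP.1 (hM.containsSubdivision (fun a b h ↦ (ht a b h).2) fun a ↦ ?_)
    let e : (completeGraph (Fin 5)).neighborSet a ↪ Fin 4 :=
      ⟨fun b ↦ (finSuccAboveEquiv a).symm ⟨b.1, fun h ↦ b.2 h.symm⟩, fun b c h ↦ by
        simpa [Subtype.ext_iff] using h⟩
    convert (hs a).comp e using 1
    funext b
    have : a.succAbove (e b) = b.1 := congrArg Subtype.val
      ((finSuccAboveEquiv a).apply_symm_apply ⟨b.1, fun h ↦ b.2 h.symm⟩)
    simp [this]
  · push Not at hs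
    obtain ⟨a, ha⟩ := hs
    have hne : ∀ k, a.succAbove k ≠ a := fun k ↦ a.succAbove_ne k
    have hinj : ∀ {k l}, a.succAbove k = a.succAbove l → k = l :=
      fun h ↦ Fin.succAbove_right_injective h
    have htk : ∀ k, t a (a.succAbove k) ∈ M a := fun k ↦ (ht _ _ (hne k).symm).1
    have htk' : ∀ k, t (a.succAbove k) a ∈ M (a.succAbove k) := fun k ↦ (ht _ _ (hne k)).1
    have hta : ∀ k, G.Adj (t a (a.succAbove k)) (t (a.succAbove k) a) :=
      fun k ↦ (ht _ _ (hne k).symm).2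
    obtain ⟨B₁, B₂, i, j, hij, h₁, h₂, hc₁, hc₂, hd, hadj, hi, hj, hk⟩ :=
      ((hM.conn a).hasSpider_fin_four_or_split _ htk).resolve_left ha
    have hfin : ∀ i j : Fin 4, i ≠ j →
        ∃ k l : Fin 4, k ≠ l ∧ k ≠ i ∧ k ≠ j ∧ l ≠ i ∧ l ≠ j := by decide
    obtain ⟨k, l, hkl, hki, hkj, hli, hlj⟩ := hfin i j hij
    have hk' := hk k hki hkj
    have hl' := hk l hli hlj
    have hMM : ∀ p q, p ≠ q → ∃ x ∈ M (a.succAbove p), ∃ y ∈ M (a.succAbove q), G.Adj x y :=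
      fun p q hpq ↦ hM.adj _ _ fun h ↦ hpq (hinj h)
    have hdM : ∀ p q x, x ∈ M (a.succAbove p) → x ∈ M (a.succAbove q) → p = q :=
      fun p q x hx hx' ↦ hinj (hM.disj _ _ x hx hx')
    have hda : ∀ p x, x ∈ M (a.succAbove p) → x ∉ M a :=
      fun p x hx hx' ↦ hne p (hM.disj _ _ x hx hx')
    refine fun hP ↦ hP.2 (IsModel.containsSubdivision_completeBipartiteGraph
      (isModel_completeBipartiteGraph (A := ![B₁, M (a.succAbove k), M (a.succAbove l)])
        (B := ![B₂, M (a.succAbove i), M (a.succAbove j)]) ?_ ?_ ?_ ?_ ?_ ?_))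
    · simp [Fin.forall_fin_succ, hc₁, hM.conn]
    · simp [Fin.forall_fin_succ, hc₂, hM.conn]
    · intro p q x
      fin_cases p <;> fin_cases q <;> simp <;> grind
    · intro p q x
      fin_cases p <;> fin_cases q <;> simp <;> grind
    · intro p q x
      fin_cases p <;> fin_cases q <;> simp <;> grind
    · intro p q
      fin_cases p <;> fin_cases q
      · exact hadj
      · exact ⟨_, hi, _, htk' i, hta i⟩
      · exact ⟨_, hj, _, htk' j, hta j⟩
      · exact ⟨_, htk' k, _, hk', (hta k).symm⟩
      · exact hMM k i hki
      · exact hMM k j hkj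
      · exact ⟨_, htk' l, _, hl', (hta l).symm⟩
      · exact hMM l i hli
      · exact hMM l j hlj

end Kuratowski

section CliqueSum

variable {V W : Type*} {G G' : SimpleGraph V} {K : SimpleGraph W} {X B Y S : Set V}
  {M : W → Set V}

/-- Detours through `B` can be avoided if `B` attaches to the rest of the graph in a clique. -/
theorem WalkJoined.restrict {u v : V} (hBX : ∀ u v, u ∉ B → v ∈ B → G.Adj u v → u ∈ X)
    (hX : ∀ x ∈ X, ∀ y ∈ X, x ≠ y → G.Adj x y) (hXB : ∀ x ∈ X, x ∉ B)
    (h : WalkJoined G S u v) (hv : v ∉ B) :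
    (u ∉ B → WalkJoined G (S \ B) u v) ∧
      (u ∈ B → ∃ x ∈ X, x ∈ S ∧ WalkJoined G (S \ B) x v) := by
  obtain ⟨p, hp⟩ := h
  induction p with
  | nil => exact ⟨fun h ↦ .refl ⟨hp _ (by simp), h⟩, fun h ↦ absurd h hv⟩
  | @cons a b c hab p ih =>
    simp only [Walk.support_cons, List.mem_cons, forall_eq_or_imp] at hp
    obtain ⟨ih₁, ih₂⟩ := ih hv hp.2
    have hbS := hp.2 b (by simp)
    refine ⟨fun ha ↦ ?_, fun ha ↦ ?_⟩
    · by_cases hb : b ∈ B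
      · obtain ⟨x, hx, hxS, hxv⟩ := ih₂ hb
        by_cases hax : a = x
        · exact hax ▸ hxv
        · exact (WalkJoined.of_adj (S := S \ B) (hX a (hBX a b ha hb hab) x hx hax) ⟨hp.1, ha⟩
            ⟨hxS, hXB x hx⟩).trans hxv
      · exact (WalkJoined.of_adj (S := S \ B) hab ⟨hp.1, ha⟩ ⟨hbS, hb⟩).trans (ih₁ hb)
    · by_cases hb : b ∈ B
      · exact ih₂ hb
      · exact ⟨b, hBX b a hb ha hab.symm, hbS, ih₁ hb⟩

theorem IsModel.diff (hM : IsModel K G M) (hBX : ∀ u v, u ∉ B → v ∈ B → G.Adj u v → u ∈ X)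
    (hX : ∀ x ∈ X, ∀ y ∈ X, x ≠ y → G.Adj x y) (hXB : ∀ x ∈ X, x ∉ B)
    (hMB : ∀ w, ∃ u ∈ M w, u ∉ B) : IsModel K G fun w ↦ M w \ B where
  conn w u hu v hv := ((hM.conn w u hu.1 v hv.1).restrict hBX hX hXB hv.2).1 hu.2
  disj v w x hv hw := hM.disj v w x hv.1 hw.1
  adj v w h := by
    have hmeet : ∀ w, ∀ x ∈ M w, x ∈ B → ∃ z ∈ X, z ∈ M w := by
      intro w x hx hxB
      obtain ⟨u, hu, huB⟩ := hMB w
      obtain ⟨z, hz, hzM, -⟩ := ((hM.conn w x hx u hu).restrict hBX hX hXB huB).2 hxB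
      exact ⟨z, hz, hzM⟩
    have hmeet' : ∀ v w, ∀ x ∈ M v, x ∈ B → ∀ y ∈ M w, G.Adj x y → ∃ z ∈ X, z ∈ M w := by
      intro v w x hx hxB y hy hxy
      by_cases hyB : y ∈ B
      · exact hmeet w y hy hyB
      · exact ⟨y, hBX y x hyB hxB hxy.symm, hy⟩
    obtain ⟨x, hx, y, hy, hxy⟩ := hM.adj v w h
    by_cases hB : x ∈ B ∨ y ∈ B
    · obtain ⟨⟨a, ha, haM⟩, b, hb, hbM⟩ : (∃ z ∈ X, z ∈ M v) ∧ ∃ z ∈ X, z ∈ M w := by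
        rcases hB with hB | hB
        · exact ⟨hmeet v x hx hB, hmeet' v w x hx hB y hy hxy⟩
        · exact ⟨hmeet' w v y hy hB x hx hxy.symm, hmeet w y hy hB⟩
      refine ⟨a, ⟨haM, hXB a ha⟩, b, ⟨hbM, hXB b hb⟩, hX a ha b hb ?_⟩
      rintro rfl
      exact h.ne (hM.disj v w a haM hbM)
    · push Not at hB
      exact ⟨x, ⟨hx, hB.1⟩, y, ⟨hy, hB.2⟩, hxy⟩

/-- A model that does not use edges inside `X` is a model in the graph without these edges. -/
theorem IsModel.of_sparse (hM : IsModel K G' M)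
    (hGG' : ∀ u v, G'.Adj u v → G.Adj u v ∨ u ∈ X ∧ v ∈ X)
    (hs : ∀ v w, v = w ∨ K.Adj v w → ∀ x ∈ X, x ∈ M v → ∀ y ∈ X, y ∈ M w → x = y) :
    IsModel K G M where
  conn w u hu v hv := (hM.conn w u hu v hv).lift le_rfl fun x hx y hy hxy ↦ by
    rcases hGG' x y hxy with h | ⟨hxX, hyX⟩
    · exact .of_adj h hx hy
    · exact absurd (hs w w (.inl rfl) x hxX hx y hyX hy) hxy.ne
  disj := hM.disj
  adj v w h := by
    obtain ⟨x, hx, y, hy, hxy⟩ := hM.adj v w h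
    refine ⟨x, hx, y, hy, (hGG' x y hxy).resolve_right fun ⟨hxX, hyX⟩ ↦ ?_⟩
    exact hxy.ne (hs v w (.inr h) x hxX hx y hyX hy)

/-- If all uses of edges inside `X` involve the branch set of `w₀`, then they can be replaced by
connections through a connected set `Y` attached to all of `X`. -/
theorem IsModel.exists_absorb (hM : IsModel K G' M)
    (hGG' : ∀ u v, G'.Adj u v → G.Adj u v ∨ u ∈ X ∧ v ∈ X)
    (hY : ConnOn G Y) (hXY : ∀ x ∈ X, ∃ y ∈ Y, G.Adj x y) (hMY : ∀ w, ∀ x ∈ M w, x ∉ Y) (w₀ : W)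
    (hs : ∀ v w, v ≠ w₀ → w ≠ w₀ → v = w ∨ K.Adj v w →
      ∀ x ∈ X, x ∈ M v → ∀ y ∈ X, y ∈ M w → x = y) :
    ∃ N : W → Set V, IsModel K G N := by
  let N : W → Set V := fun w ↦ {x | x ∈ M w ∨ w = w₀ ∧ x ∈ Y ∧ ∃ z ∈ X, z ∈ M w}
  have hMN : ∀ w, M w ⊆ N w := fun w x hx ↦ .inl hx
  have hYN : ∀ x ∈ X, x ∈ M w₀ → Y ⊆ N w₀ := fun x hx hxM y hy ↦ .inr ⟨rfl, hy, x, hx, hxM⟩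
  have hthrough : ∀ x ∈ X, x ∈ M w₀ → ∀ y ∈ Y, WalkJoined G (N w₀) x y := by
    intro x hx hxM y hy
    obtain ⟨z, hz, hxz⟩ := hXY x hx
    exact (WalkJoined.of_adj hxz (hMN _ hxM) (hYN x hx hxM hz)).trans
      ((hY z hz y hy).mono (hYN x hx hxM))
  have hMconn : ∀ w, ∀ u ∈ M w, ∀ v ∈ M w, WalkJoined G (N w) u v := by
    intro w u hu v hv
    refine (hM.conn w u hu v hv).lift (hMN w) fun x hx y hy hxy ↦ ?_
    rcases hGG' x y hxy with h | ⟨hxX, hyX⟩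
    · exact .of_adj h (.inl hx) (.inl hy)
    · by_cases hw : w = w₀
      · subst hw
        obtain ⟨z, hz, -⟩ := hXY x hxX
        exact (hthrough x hxX hx z hz).trans (hthrough y hyX hy z hz).symm
      · exact absurd (hs w w hw hw (.inl rfl) x hxX hx y hyX hy) hxy.ne
  refine ⟨N, fun w u hu v hv ↦ ?_, ?_, fun v w h ↦ ?_⟩
  · rcases hu with hu | ⟨rfl, hu, x, hxX, hx⟩
    · rcases hv with hv | ⟨rfl, hv, x, hxX, hx⟩
      · exact hMconn w u hu v hv
      · exact (hMconn w u hu x hx).trans (hthrough x hxX hx v hv)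
    · rcases hv with hv | ⟨-, hv, -⟩
      · exact (hthrough x hxX hx u hu).symm.trans (hMconn w x hx v hv)
      · exact (hthrough x hxX hx u hu).symm.trans (hthrough x hxX hx v hv)
  · rintro v w x (hv | ⟨rfl, hv, -⟩) (hw | ⟨rfl, hw, -⟩)
    · exact hM.disj v w x hv hw
    · exact absurd hw (hMY v x hv)
    · exact absurd hv (hMY w x hw)
    · rfl
  · obtain ⟨x, hx, y, hy, hxy⟩ := hM.adj v w h
    rcases hGG' x y hxy with hG | ⟨hxX, hyX⟩
    · exact ⟨x, .inl hx, y, .inl hy, hG⟩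
    · by_cases hv : v = w₀
      · subst hv
        obtain ⟨z, hz, hyz⟩ := hXY y hyX
        exact ⟨z, hYN x hxX hx hz, y, .inl hy, hyz.symm⟩
      · by_cases hw : w = w₀
        · subst hw
          obtain ⟨z, hz, hxz⟩ := hXY x hxX
          exact ⟨x, .inl hx, z, hYN y hyX hy hz, hxz⟩
        · exact absurd (hs v w hv hw (.inr h) x hxX hx y hyX hy) hxy.ne

theorem IsModel.exists_absorb_or_triangle [Nonempty W] {x₁ x₂ x₃ : V} (hM : IsModel K G' M)
    (hGG' : ∀ u v, G'.Adj u v →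
      G.Adj u v ∨ u ∈ ({x₁, x₂, x₃} : Set V) ∧ v ∈ ({x₁, x₂, x₃} : Set V))
    (hY : ConnOn G Y) (hXY : ∀ x ∈ ({x₁, x₂, x₃} : Set V), ∃ y ∈ Y, G.Adj x y)
    (hMY : ∀ w, ∀ x ∈ M w, x ∉ Y) :
    (∃ N : W → Set V, IsModel K G N) ∨
      ∃ w₁ w₂ w₃, K.Adj w₁ w₂ ∧ K.Adj w₁ w₃ ∧ K.Adj w₂ w₃ ∧
        x₁ ∈ M w₁ ∧ x₂ ∈ M w₂ ∧ x₃ ∈ M w₃ := by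
  rw [or_iff_not_imp_left]
  intro hN
  have hbad : ∀ w₀, ∃ v w, v ≠ w₀ ∧ w ≠ w₀ ∧ (v = w ∨ K.Adj v w) ∧
      ∃ x ∈ ({x₁, x₂, x₃} : Set V), x ∈ M v ∧ ∃ y ∈ ({x₁, x₂, x₃} : Set V), y ∈ M w ∧ x ≠ y := by
    intro w₀
    by_contra! h
    exact hN (hM.exists_absorb hGG' hY hXY hMY w₀
      fun v w hv hw hvw x hx hxv y hy hyw ↦ h v w hv hw hvw x hx hxv y hy hyw)
  have hdisj := hM.disj
  have key : ∀ a b c : V, ({x₁, x₂, x₃} : Set V) = {a, b, c} → ∀ w, a ∈ M w →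
      ∃ v u, v ≠ w ∧ u ≠ w ∧ (v = u ∨ K.Adj v u) ∧ b ∈ M v ∧ c ∈ M u := by
    intro a b c habc w ha
    obtain ⟨v, u, hv, hu, hvu, x, hx, hxv, y, hy, hyu, hxy⟩ := hbad w
    rw [habc] at hx hy
    simp only [Set.mem_insert_iff, Set.mem_singleton_iff] at hx hy
    rcases hx with rfl | rfl | rfl
    · exact absurd (hdisj _ _ _ hxv ha) hv
    · rcases hy with rfl | rfl | rfl
      · exact absurd (hdisj _ _ _ hyu ha) hu
      · exact absurd rfl hxy
      · exact ⟨v, u, hv, hu, hvu, hxv, hyu⟩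
    · rcases hy with rfl | rfl | rfl
      · exact absurd (hdisj _ _ _ hyu ha) hu
      · exact ⟨u, v, hu, hv, hvu.imp Eq.symm Adj.symm, hyu, hxv⟩
      · exact absurd rfl hxy
  have h₁ := key x₁ x₂ x₃ rfl
  have h₂ := key x₂ x₁ x₃ (Set.insert_comm _ _ _)
  have h₃ := key x₃ x₁ x₂ (by grind)
  obtain ⟨w₀⟩ := ‹Nonempty W›
  have hex : ∃ w, x₁ ∈ M w ∨ x₂ ∈ M w ∨ x₃ ∈ M w := by
    obtain ⟨v, w, -, -, -, x, hx, hxv, -⟩ := hbad w₀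
    simp only [Set.mem_insert_iff, Set.mem_singleton_iff] at hx
    exact ⟨v, by grind⟩
  obtain ⟨w₁, w₂, w₃, m₁, m₂, m₃⟩ :
      ∃ w₁ w₂ w₃, x₁ ∈ M w₁ ∧ x₂ ∈ M w₂ ∧ x₃ ∈ M w₃ := by
    obtain ⟨w, hw | hw | hw⟩ := hex
    · obtain ⟨v, u, -, -, -, hv, hu⟩ := h₁ w hw
      exact ⟨w, v, u, hw, hv, hu⟩
    · obtain ⟨v, u, -, -, -, hv, hu⟩ := h₂ w hw
      exact ⟨v, w, u, hv, hw, hu⟩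
    · obtain ⟨v, u, -, -, -, hv, hu⟩ := h₃ w hw
      exact ⟨v, u, w, hv, hu, hw⟩
  have h₁ := h₁ w₁ m₁
  have h₂ := h₂ w₂ m₂
  have h₃ := h₃ w₃ m₃
  refine ⟨w₁, w₂, w₃, ?_, ?_, ?_, m₁, m₂, m₃⟩
  · obtain ⟨v, u, hv, hu, hvu, hxv, hxu⟩ := h₃
    obtain rfl := hdisj _ _ _ hxv m₁
    obtain rfl := hdisj _ _ _ hxu m₂
    obtain ⟨v', u', hv', -, -, hxv', -⟩ := h₂
    exact hvu.resolve_left (hdisj _ _ _ hxv' m₁ ▸ hv')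
  · obtain ⟨v, u, hv, hu, hvu, hxv, hxu⟩ := h₂
    obtain rfl := hdisj _ _ _ hxv m₁
    obtain rfl := hdisj _ _ _ hxu m₃
    obtain ⟨v', u', hv', -, -, hxv', -⟩ := h₃
    exact hvu.resolve_left (hdisj _ _ _ hxv' m₁ ▸ hv')
  · obtain ⟨v, u, hv, hu, hvu, hxv, hxu⟩ := h₁
    obtain rfl := hdisj _ _ _ hxv m₂
    obtain rfl := hdisj _ _ _ hxu m₃
    obtain ⟨v', u', -, hw, -, -, hxv'⟩ := h₃
    exact hvu.resolve_left (hdisj _ _ _ hxv' m₂ ▸ hw)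

/-- A triangle on `x₁, x₂, x₃` in a `K₅` model can be traded for a connected set `Y` attached to
these three vertices, giving a `K₃,₃` model. -/
theorem IsModel.exists_completeBipartiteGraph_of_triangle {M : Fin 5 → Set V} {x₁ x₂ x₃ : V}
    (hM : IsModel (completeGraph (Fin 5)) G' M)
    (hGG' : ∀ u v, G'.Adj u v →
      G.Adj u v ∨ u ∈ ({x₁, x₂, x₃} : Set V) ∧ v ∈ ({x₁, x₂, x₃} : Set V))
    (hY : ConnOn G Y) (hXY : ∀ x ∈ ({x₁, x₂, x₃} : Set V), ∃ y ∈ Y, G.Adj x y)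
    (hMY : ∀ w, ∀ x ∈ M w, x ∉ Y) {w₁ w₂ w₃ : Fin 5} (h₁₂ : w₁ ≠ w₂) (h₁₃ : w₁ ≠ w₃)
    (h₂₃ : w₂ ≠ w₃) (h₁ : x₁ ∈ M w₁) (h₂ : x₂ ∈ M w₂) (h₃ : x₃ ∈ M w₃) :
    ∃ N, IsModel (completeBipartiteGraph (Fin 3) (Fin 3)) G N := by
  have hfin : ∀ a b c : Fin 5, ∃ d e : Fin 5,
      d ≠ e ∧ d ≠ a ∧ d ≠ b ∧ d ≠ c ∧ e ≠ a ∧ e ≠ b ∧ e ≠ c := by decide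
  obtain ⟨w₄, w₅, h₄₅, h₄₁, h₄₂, h₄₃, h₅₁, h₅₂, h₅₃⟩ := hfin w₁ w₂ w₃
  have hdisj := hM.disj
  have hX : ∀ x ∈ ({x₁, x₂, x₃} : Set V), ∀ w, x ∈ M w →
      x = x₁ ∧ w = w₁ ∨ x = x₂ ∧ w = w₂ ∨ x = x₃ ∧ w = w₃ := by
    rintro x (rfl | rfl | rfl) w hw
    · exact .inl ⟨rfl, hdisj _ _ _ hw h₁⟩
    · exact .inr (.inl ⟨rfl, hdisj _ _ _ hw h₂⟩)
    · exact .inr (.inr ⟨rfl, hdisj _ _ _ hw h₃⟩)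
  have hconn : ∀ w, ConnOn G (M w) := by
    intro w u hu v hv
    refine (hM.conn w u hu v hv).lift le_rfl fun x hx y hy hxy ↦ ?_
    rcases hGG' x y hxy with h | ⟨hxX, hyX⟩
    · exact .of_adj h hx hy
    · refine absurd ?_ hxy.ne
      have hx' := hX x hxX w hx
      have hy' := hX y hyX w hy
      grind
  have hadj : ∀ v w, v ≠ w → w ≠ w₁ → w ≠ w₂ → w ≠ w₃ → ∃ x ∈ M v, ∃ y ∈ M w, G.Adj x y := by
    intro v w hvw hw₁ hw₂ hw₃
    obtain ⟨x, hx, y, hy, hxy⟩ := hM.adj v w hvw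
    refine ⟨x, hx, y, hy, (hGG' x y hxy).resolve_right fun ⟨_, hyX⟩ ↦ ?_⟩
    have hy' := hX y hyX w hy
    grind
  have hadjY : ∀ x ∈ ({x₁, x₂, x₃} : Set V), ∀ w, x ∈ M w → ∃ x ∈ M w, ∃ y ∈ Y, G.Adj x y := by
    intro x hx w hw
    obtain ⟨y, hy, hxy⟩ := hXY x hx
    exact ⟨x, hw, y, hy, hxy⟩
  refine ⟨_, isModel_completeBipartiteGraph (A := ![M w₁, M w₂, M w₃]) (B := ![M w₄, M w₅, Y])
    ?_ ?_ ?_ ?_ ?_ ?_⟩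
  · simp [Fin.forall_fin_succ, hconn]
  · simp [Fin.forall_fin_succ, hconn, hY]
  · intro p q x
    fin_cases p <;> fin_cases q <;> simp <;> grind
  · intro p q x
    fin_cases p <;> fin_cases q <;> simp <;> grind
  · intro p q x
    fin_cases p <;> fin_cases q <;> simp <;> grind
  · intro p q
    fin_cases p <;> fin_cases q
    · exact hadj w₁ w₄ h₄₁.symm h₄₁ h₄₂ h₄₃
    · exact hadj w₁ w₅ h₅₁.symm h₅₁ h₅₂ h₅₃
    · exact hadjY x₁ (by simp) w₁ h₁
    · exact hadj w₂ w₄ h₄₂.symm h₄₁ h₄₂ h₄₃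
    · exact hadj w₂ w₅ h₅₂.symm h₅₁ h₅₂ h₅₃
    · exact hadjY x₂ (by simp) w₂ h₂
    · exact hadj w₃ w₄ h₄₃.symm h₄₁ h₄₂ h₄₃
    · exact hadj w₃ w₅ h₅₃.symm h₅₁ h₅₂ h₅₃
    · exact hadjY x₃ (by simp) w₃ h₃

end CliqueSum

section Separation

variable {V : Type*} {G : SimpleGraph V} {S X : Set V} {u v : V}

theorem SimpleGraph.Preconnected.walkJoined (h : (G.induce S).Preconnected) (hu : u ∈ S)
    (hv : v ∈ S) : WalkJoined G S u v := by
  obtain ⟨p⟩ := h ⟨u, hu⟩ ⟨v, hv⟩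
  refine ⟨p.map (Embedding.induce S).toHom, fun x hx ↦ ?_⟩
  replace hx := (Walk.support_map (Embedding.induce S).toHom p) ▸ hx
  obtain ⟨y, -, rfl⟩ := List.mem_map.1 hx
  exact y.2

theorem ConnOn.preconnected (h : ConnOn G S) : (G.induce S).Preconnected := by
  rintro ⟨u, hu⟩ ⟨v, hv⟩
  obtain ⟨p, hp⟩ := h u hu v hv
  exact ⟨p.induce S hp⟩

theorem connOn_setOf_walkJoined (a : V) : ConnOn G {v | WalkJoined G S a v} := by
  refine .of_center a fun u hu ↦ WalkJoined.symm ?_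
  obtain ⟨p, hp⟩ := hu
  exact ⟨p, fun x hx ↦ walkJoined_of_mem_support p hx hp⟩

theorem ThreeConnected.exists_adj_of_ncard_le_three [Fintype V] (h3 : ThreeConnected G)
    (hX : X.ncard ≤ 3) {a x : V} (ha : a ∉ X) (hx : x ∈ X) :
    ∃ v, WalkJoined G Xᶜ a v ∧ G.Adj v x := by
  have hcard : (X \ {x}).ncard ≤ 2 := by
    have := Set.ncard_sdiff_singleton_add_one hx
    omega
  obtain ⟨p, hp⟩ := (h3.2 _ hcard).preconnected.walkJoined (u := a) (v := x)
    (by simp [ha]) (by simp)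
  replace hp : ∀ y ∈ p.support, y ∈ X → y = x := fun y hy hyX ↦ by
    by_contra hyx
    exact hp y hy ⟨hyX, hyx⟩
  clear hcard hX h3
  induction p with
  | nil => exact absurd hx ha
  | @cons a b c hab p ih =>
    simp only [Walk.support_cons, List.mem_cons, forall_eq_or_imp] at hp
    by_cases hb : b = c
    · exact ⟨a, .refl ha, hb ▸ hab⟩
    · have hbX : b ∉ X := fun h ↦ hb (hp.2 b (by simp) h)
      obtain ⟨v, hv, hvc⟩ := ih hbX hx hp.2
      exact ⟨v, (WalkJoined.of_adj hab ha hbX).trans hv, hvc⟩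

theorem ThreeConnected.exists_not_walkJoined [Fintype V] (h3 : ThreeConnected G)
    (hX : X.ncard ≤ 3) (hcut : ¬ (G.induce Xᶜ).Connected) :
    ∃ a b, a ∉ X ∧ b ∉ X ∧ ¬ WalkJoined G Xᶜ a b := by
  by_contra! h
  have hne : ¬ Nonempty ↑Xᶜ := fun hne ↦
    hcut ⟨ConnOn.preconnected fun u hu v hv ↦ h u v hu hv⟩
  have hXu : X = Set.univ := by
    rw [Set.eq_univ_iff_forall]
    intro x
    by_contra hx
    exact hne ⟨⟨x, hx⟩⟩
  have h4 := h3.1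
  rw [hXu, Set.ncard_univ, Nat.card_eq_fintype_card] at hX
  omega

end Separation

section InducedPath

variable {V : Type*} {G : SimpleGraph V} {X D : Set V}

theorem containsInduced_pathGraph_five_s15 (f : Fin 5 → V)
    (hf : ∀ i j, G.Adj (f i) (f j) ↔ (pathGraph 5).Adj i j) :
    ContainsInduced (pathGraph 5) G := by
  have hinj : Function.Injective f := by
    intro i j hij
    have h : ∀ k, (pathGraph 5).Adj i k ↔ (pathGraph 5).Adj j k := fun k ↦ by
      rw [← hf, ← hf, hij]
    simp only [pathGraph_adj] at h
    clear hij
    revert i j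
    decide
  exact ⟨Set.range f, ⟨Embedding.isoInduceRange ⟨⟨f, hinj⟩, hf _ _⟩⟩⟩

theorem containsInduced_pathGraph_five_of_adj {a b c d e : V} (hab : G.Adj a b) (hbc : G.Adj b c)
    (hcd : G.Adj c d) (hde : G.Adj d e) (hac : ¬ G.Adj a c) (had : ¬ G.Adj a d)
    (hae : ¬ G.Adj a e) (hbd : ¬ G.Adj b d) (hbe : ¬ G.Adj b e) (hce : ¬ G.Adj c e) :
    ContainsInduced (pathGraph 5) G := by
  refine containsInduced_pathGraph_five_s15 ![a, b, c, d, e] fun i j ↦ ?_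
  rw [pathGraph_adj]
  fin_cases i <;> fin_cases j <;> simp [*, G.adj_comm b a, G.adj_comm c b, G.adj_comm d c,
    G.adj_comm e d, G.adj_comm c a, G.adj_comm d a, G.adj_comm e a, G.adj_comm d b,
    G.adj_comm e b, G.adj_comm e c]

/-- The first two vertices after `u` on a walk that leaves the neighbourhood of `u`. -/
theorem WalkJoined.exists_adj_adj {S : Set V} {u s t : V} (h : WalkJoined G S s t)
    (hus : G.Adj u s) (hut : ¬ G.Adj u t) :
    ∃ x ∈ S, ∃ y ∈ S, G.Adj u x ∧ G.Adj x y ∧ ¬ G.Adj u y := by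
  obtain ⟨p, hp⟩ := h
  induction p with
  | nil => exact absurd hus hut
  | @cons a b c hab p ih =>
    simp only [Walk.support_cons, List.mem_cons, forall_eq_or_imp] at hp
    by_cases hub : G.Adj u b
    · exact ih hub hut hp.2
    · exact ⟨a, hp.1, b, hp.2 b (by simp), hus, hab, hub⟩

/-- An induced path with end `p, q, x` is prolonged into a connected set `D` attached to the
nonadjacent vertices `x` and `x'`. -/
theorem ConnOn.containsInduced_pathGraph_five (hD : ConnOn G D) {p q x x' : V}
    (hpD : ∀ v ∈ D, ¬ G.Adj p v) (hqD : ∀ v ∈ D, ¬ G.Adj q v)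
    (hxD : ∃ v ∈ D, G.Adj x v) (hxD' : ∃ v ∈ D, G.Adj x' v)
    (hpq : G.Adj p q) (hqx : G.Adj q x) (hpx : ¬ G.Adj p x) (hpx' : ¬ G.Adj p x')
    (hqx' : ¬ G.Adj q x') (hxx' : ¬ G.Adj x x') : ContainsInduced (pathGraph 5) G := by
  obtain ⟨s, hs, hxs⟩ := hxD
  obtain ⟨t, ht, hxt⟩ := hxD'
  have hst : WalkJoined G (insert x' D) s x' :=
    ((hD s hs t ht).mono (Set.subset_insert _ _)).trans
      (.of_adj hxt.symm (.inr ht) (.inl rfl))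
  obtain ⟨y, hy, z, hz, hxy, hyz, hxz⟩ := hst.exists_adj_adj hxs hxx'
  have hp : ∀ v ∈ insert x' D, ¬ G.Adj p v := by
    rintro v (rfl | hv)
    exacts [hpx', hpD v hv]
  have hq : ∀ v ∈ insert x' D, ¬ G.Adj q v := by
    rintro v (rfl | hv)
    exacts [hqx', hqD v hv]
  exact containsInduced_pathGraph_five_of_adj hpq hqx hxy hyz hpx (hp y hy) (hp z hz) (hq y hy)
    (hq z hz) hxz

end InducedPath

section AddClique

variable {V : Type*} {G G' : SimpleGraph V}

theorem not_containsInduced_pathGraph_five_of_clique [Fintype V] {X : Set V} (h3 : ThreeConnected G)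
    (hG : ¬ ContainsInduced (pathGraph 5) G) (hX : X.ncard ≤ 3)
    (hcut : ¬ (G.induce Xᶜ).Connected)
    (hG' : ∀ u v, G'.Adj u v ↔ G.Adj u v ∨ u ≠ v ∧ u ∈ X ∧ v ∈ X) :
    ¬ ContainsInduced (pathGraph 5) G' := by
  rintro ⟨s, ⟨φ⟩⟩
  obtain ⟨a, b, haX, hbX, hab⟩ := h3.exists_not_walkJoined hX hcut
  let f : Fin 5 → V := fun i ↦ φ i
  have hf : ∀ i j, G'.Adj (f i) (f j) ↔ (pathGraph 5).Adj i j := fun i j ↦ φ.map_adj_iff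
  have hfinj : Function.Injective f := Subtype.val_injective.comp φ.injective
  have hle : ∀ {u v}, G.Adj u v → G'.Adj u v := fun h ↦ (hG' _ _).2 (.inl h)
  obtain ⟨k, l, hkl, hkl'⟩ : ∃ k l, (pathGraph 5).Adj k l ∧ ¬ G.Adj (f k) (f l) := by
    by_contra! h
    exact hG (containsInduced_pathGraph_five_s15 f fun i j ↦ ⟨fun hij ↦ (hf i j).1 (hle hij), h i j⟩)
  obtain ⟨-, hk, hl⟩ := ((hG' _ _).1 ((hf k l).2 hkl)).resolve_left hkl'
  have hnX : ∀ m, m ≠ k → m ≠ l → f m ∉ X := by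
    intro m hmk hml hm
    have h₁ : G'.Adj (f m) (f k) := (hG' _ _).2 (.inr ⟨hfinj.ne hmk, hm, hk⟩)
    have h₂ : G'.Adj (f m) (f l) := (hG' _ _).2 (.inr ⟨hfinj.ne hml, hm, hl⟩)
    rw [hf, pathGraph_adj] at h₁ h₂
    rw [pathGraph_adj] at hkl
    omega
  obtain ⟨p, q, x, x', hpq, hqx, hpx, hpx', hqx', hxx', hpX, hqX, hx, hx'⟩ :
      ∃ p q x x', G.Adj p q ∧ G.Adj q x ∧ ¬ G.Adj p x ∧ ¬ G.Adj p x' ∧ ¬ G.Adj q x' ∧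
        ¬ G.Adj x x' ∧ p ∉ X ∧ q ∉ X ∧ x ∈ X ∧ x' ∈ X := by
    obtain ⟨i, j, m, n, hij, hjm, him, hin, hjn, hmn⟩ : ∃ i j m n : Fin 5,
        (pathGraph 5).Adj i j ∧ (pathGraph 5).Adj j m ∧ ¬ (pathGraph 5).Adj i m ∧
        ¬ (pathGraph 5).Adj i n ∧ ¬ (pathGraph 5).Adj j n ∧ (m = k ∧ n = l ∨ m = l ∧ n = k) := by
      simp only [pathGraph_adj] at hkl ⊢
      clear hnX hk hl hkl'
      revert k l
      decide
    have hnadj : ∀ {i j}, ¬ (pathGraph 5).Adj i j → ¬ G.Adj (f i) (f j) :=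
      fun h h' ↦ h ((hf _ _).1 (hle h'))
    have hmn' : (pathGraph 5).Adj m n := by
      rcases hmn with ⟨rfl, rfl⟩ | ⟨rfl, rfl⟩
      exacts [hkl, hkl.symm]
    have hi : f i ∉ X := by
      refine hnX i ?_ ?_ <;> rintro rfl <;> rcases hmn with ⟨rfl, rfl⟩ | ⟨rfl, rfl⟩ <;>
        first | exact hin hmn' | exact him hmn'.symm
    have hj : f j ∉ X := by
      refine hnX j ?_ ?_ <;> rintro rfl <;> rcases hmn with ⟨rfl, rfl⟩ | ⟨rfl, rfl⟩ <;>
        first | exact hjn hmn' | exact hin hij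
    have hadj : ∀ {i j}, (pathGraph 5).Adj i j → f i ∉ X → G.Adj (f i) (f j) :=
      fun h hi ↦ ((hG' _ _).1 ((hf _ _).2 h)).resolve_right fun h' ↦ hi h'.2.1
    refine ⟨f i, f j, f m, f n, hadj hij hi, hadj hjm hj, hnadj him, hnadj hin, hnadj hjn, ?_,
      hi, hj, ?_, ?_⟩ <;> rcases hmn with ⟨rfl, rfl⟩ | ⟨rfl, rfl⟩
    exacts [hkl', fun h ↦ hkl' h.symm, hk, hl, hl, hk]
  obtain ⟨d, hdX, hpd⟩ : ∃ d, d ∉ X ∧ ¬ WalkJoined G Xᶜ d p := by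
    by_cases h : WalkJoined G Xᶜ a p
    · exact ⟨b, hbX, fun h' ↦ hab (h.trans h'.symm)⟩
    · exact ⟨a, haX, h⟩
  have hqd : ¬ WalkJoined G Xᶜ d q := fun h ↦ hpd (h.trans (.of_adj hpq.symm hqX hpX))
  have hatt : ∀ z ∈ X, ∃ v ∈ {v | WalkJoined G Xᶜ d v}, G.Adj z v := fun z hz ↦ by
    obtain ⟨v, hv, hvz⟩ := h3.exists_adj_of_ncard_le_three hX hdX hz
    exact ⟨v, hv, hvz.symm⟩
  exact hG ((connOn_setOf_walkJoined d).containsInduced_pathGraph_five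
    (fun v hv h ↦ hpd (WalkJoined.trans hv (.of_adj h.symm (WalkJoined.right_mem hv) hpX)))
    (fun v hv h ↦ hqd (WalkJoined.trans hv (.of_adj h.symm (WalkJoined.right_mem hv) hqX)))
    (hatt x hx) (hatt x' hx') hpq hqx hpx hpx' hqx' hxx')

theorem IsModel.not_isPlanar_of_completeGraph_of_side {B Y : Set V} {x₁ x₂ x₃ : V}
    {M : Fin 5 → Set V} (hM : IsModel (completeGraph (Fin 5)) G' M)
    (hG' : ∀ u v, G'.Adj u v ↔
      G.Adj u v ∨ u ≠ v ∧ u ∈ ({x₁, x₂, x₃} : Set V) ∧ v ∈ ({x₁, x₂, x₃} : Set V))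
    (hBX : ∀ u v, u ∉ B → v ∈ B → G'.Adj u v → u ∈ ({x₁, x₂, x₃} : Set V))
    (hXB : ∀ x ∈ ({x₁, x₂, x₃} : Set V), x ∉ B) (hMB : ∀ w, ∃ u ∈ M w, u ∉ B)
    (hYB : Y ⊆ B) (hY : ConnOn G Y) (hXY : ∀ x ∈ ({x₁, x₂, x₃} : Set V), ∃ y ∈ Y, G.Adj x y) :
    ¬ IsPlanar G := by
  have : Nonempty V := ⟨x₁⟩
  have hN := hM.diff hBX (fun x hx y hy hxy ↦ (hG' x y).2 (.inr ⟨hxy, hx, hy⟩)) hXB hMB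
  have hGG' := fun u v h ↦ ((hG' u v).1 h).imp_right And.right
  have hMY : ∀ w, ∀ x ∈ M w \ B, x ∉ Y := fun w x hx hxY ↦ hx.2 (hYB hxY)
  rcases hN.exists_absorb_or_triangle hGG' hY hXY hMY with
    ⟨N, hN⟩ | ⟨w₁, w₂, w₃, h₁₂, h₁₃, h₂₃, h₁, h₂, h₃⟩
  · exact hN.not_isPlanar_of_completeGraph
  · obtain ⟨N, hN⟩ := hN.exists_completeBipartiteGraph_of_triangle hGG' hY hXY hMY
      h₁₂.ne h₁₃.ne h₂₃.ne h₁ h₂ h₃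
    exact fun hP ↦ hP.2 hN.containsSubdivision_completeBipartiteGraph

theorem IsModel.not_isPlanar_of_completeBipartiteGraph_of_side {B Y : Set V} {x₁ x₂ x₃ : V}
    {M : Fin 3 ⊕ Fin 3 → Set V} (hM : IsModel (completeBipartiteGraph (Fin 3) (Fin 3)) G' M)
    (hG' : ∀ u v, G'.Adj u v ↔
      G.Adj u v ∨ u ≠ v ∧ u ∈ ({x₁, x₂, x₃} : Set V) ∧ v ∈ ({x₁, x₂, x₃} : Set V))
    (hBX : ∀ u v, u ∉ B → v ∈ B → G'.Adj u v → u ∈ ({x₁, x₂, x₃} : Set V))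
    (hXB : ∀ x ∈ ({x₁, x₂, x₃} : Set V), x ∉ B) (hMB : ∀ w, ∃ u ∈ M w, u ∉ B)
    (hYB : Y ⊆ B) (hY : ConnOn G Y) (hXY : ∀ x ∈ ({x₁, x₂, x₃} : Set V), ∃ y ∈ Y, G.Adj x y) :
    ¬ IsPlanar G := by
  have : Nonempty V := ⟨x₁⟩
  have hN := hM.diff hBX (fun x hx y hy hxy ↦ (hG' x y).2 (.inr ⟨hxy, hx, hy⟩)) hXB hMB
  have hGG' := fun u v h ↦ ((hG' u v).1 h).imp_right And.right
  have hMY : ∀ w, ∀ x ∈ M w \ B, x ∉ Y := fun w x hx hxY ↦ hx.2 (hYB hxY)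
  rcases hN.exists_absorb_or_triangle hGG' hY hXY hMY with
    ⟨N, hN⟩ | ⟨w₁, w₂, w₃, h₁₂, h₁₃, h₂₃, -⟩
  · exact fun hP ↦ hP.2 hN.containsSubdivision_completeBipartiteGraph
  · rcases w₁ with w₁ | w₁ <;> rcases w₂ with w₂ | w₂ <;> rcases w₃ with w₃ | w₃ <;>
      simp at h₁₂ h₁₃ h₂₃

/-- A `K₃,₃` model with branch sets strictly on both sides of a separator `X` with at most three
vertices does not use edges inside `X`. -/
theorem IsModel.completeBipartiteGraph_of_separated [Finite V] {A B X : Set V}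
    {M : Fin 3 ⊕ Fin 3 → Set V} (hM : IsModel (completeBipartiteGraph (Fin 3) (Fin 3)) G' M)
    (hGG' : ∀ u v, G'.Adj u v → G.Adj u v ∨ u ∈ X ∧ v ∈ X) (hX : X.ncard ≤ 3)
    (hAB : ∀ u ∈ A, ∀ v ∈ B, ¬ G'.Adj u v)
    (hmeet : ∀ w, (∃ u ∈ M w, ∃ v ∈ A, G'.Adj u v) → (∃ u ∈ M w, ∃ v ∈ B, G'.Adj u v) →
      ∃ x ∈ X, x ∈ M w) {w w' : Fin 3 ⊕ Fin 3} (hw : M w ⊆ A) (hw' : M w' ⊆ B) :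
    IsModel (completeBipartiteGraph (Fin 3) (Fin 3)) G M := by
  have hnadj : ¬ (completeBipartiteGraph (Fin 3) (Fin 3)).Adj w w' := fun h ↦ by
    obtain ⟨x, hx, y, hy, hxy⟩ := hM.adj _ _ h
    exact hAB x (hw hx) y (hw' hy) hxy
  have hcommon : ∀ v, (completeBipartiteGraph (Fin 3) (Fin 3)).Adj v w →
      (completeBipartiteGraph (Fin 3) (Fin 3)).Adj v w' → ∃ x ∈ X, x ∈ M v := by
    intro v h h'
    obtain ⟨x, hx, y, hy, hxy⟩ := hM.adj _ _ h
    obtain ⟨x', hx', y', hy', hxy'⟩ := hM.adj _ _ h'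
    exact hmeet v ⟨x, hx, y, hw hy, hxy⟩ ⟨x', hx', y', hw' hy', hxy'⟩
  have key : ∀ σ : Fin 3 → Fin 3 ⊕ Fin 3, σ.Injective → (∀ i, ∃ x ∈ X, x ∈ M (σ i)) →
      ∀ v, ∀ x ∈ X, x ∈ M v → ∃ i, v = σ i ∧ ∀ y ∈ X, y ∈ M (σ i) → y = x := by
    intro σ hσ h
    choose g hgX hgM using h
    have hg : g.Injective := fun i j hij ↦ hσ (hM.disj _ _ _ (hgM i) (hij ▸ hgM j))
    have hrange : Set.range g = X := by
      refine Set.eq_of_subset_of_ncard_le (by rintro _ ⟨i, rfl⟩; exact hgX i) ?_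
      rw [← Set.image_univ, Set.ncard_image_of_injective _ hg, Set.ncard_univ]
      simpa using hX
    intro v x hx hxv
    obtain ⟨i, rfl⟩ := hrange ▸ hx
    refine ⟨i, hM.disj _ _ _ hxv (hgM i), fun y hy hyM ↦ ?_⟩
    obtain ⟨j, rfl⟩ := hrange ▸ hy
    rw [hσ (hM.disj _ _ _ hyM (hgM j))]
  refine hM.of_sparse hGG' fun u v huv x hx hxu y hy hyv ↦ ?_
  rcases w with w | w <;> rcases w' with w' | w' <;> simp at hnadj hcommon
  · obtain ⟨i, rfl, hi⟩ := key Sum.inr Sum.inr_injective hcommon u x hx hxu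
    obtain ⟨j, rfl, hj⟩ := key Sum.inr Sum.inr_injective hcommon v y hy hyv
    rw [or_iff_left (by simp), Sum.inr.injEq] at huv
    subst huv
    exact hj x hx hxu
  · obtain ⟨i, rfl, hi⟩ := key Sum.inl Sum.inl_injective hcommon u x hx hxu
    obtain ⟨j, rfl, hj⟩ := key Sum.inl Sum.inl_injective hcommon v y hy hyv
    rw [or_iff_left (by simp), Sum.inl.injEq] at huv
    subst huv
    exact hj x hx hxu

theorem isPlanar_of_clique [Fintype V] {x₁ x₂ x₃ : V} (h3 : ThreeConnected G) (hP : IsPlanar G)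
    (hcut : ¬ (G.induce ({x₁, x₂, x₃} : Set V)ᶜ).Connected)
    (hG' : ∀ u v, G'.Adj u v ↔
      G.Adj u v ∨ u ≠ v ∧ u ∈ ({x₁, x₂, x₃} : Set V) ∧ v ∈ ({x₁, x₂, x₃} : Set V)) :
    IsPlanar G' := by
  have : Nonempty V := ⟨x₁⟩
  obtain ⟨X, hXdef⟩ : ∃ X : Set V, X = {x₁, x₂, x₃} := ⟨_, rfl⟩
  have hX : X.ncard ≤ 3 := by
    rw [hXdef]
    exact (Set.ncard_insert_le _ _).trans
      (Nat.succ_le_succ ((Set.ncard_insert_le _ _).trans (by simp)))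
  rw [← hXdef] at hcut
  simp only [← hXdef] at hG'
  obtain ⟨a, b, haX, hbX, hab⟩ := h3.exists_not_walkJoined hX hcut
  let A : Set V := {v | WalkJoined G Xᶜ a v}
  let Y : Set V := {v | WalkJoined G Xᶜ b v}
  let B : Set V := {v | v ∉ X ∧ v ∉ A}
  have hAX : ∀ x ∈ X, x ∉ A := fun x hx hxA ↦ WalkJoined.right_mem hxA hx
  have hBX : ∀ x ∈ X, x ∉ B := fun x hx hxB ↦ hxB.1 hx
  have hYB : Y ⊆ B := fun y hy ↦ ⟨WalkJoined.right_mem hy, fun hyA ↦ hab (hyA.trans hy.symm)⟩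
  have hatt : ∀ c, c ∉ X → ∀ z ∈ X, ∃ v ∈ {v | WalkJoined G Xᶜ c v}, G.Adj z v :=
    fun c hc z hz ↦ by
      obtain ⟨v, hv, hvz⟩ := h3.exists_adj_of_ncard_le_three hX hc hz
      exact ⟨v, hv, hvz.symm⟩
  have hAstep : ∀ u v, u ∉ A → v ∈ A → G'.Adj u v → u ∈ X := by
    intro u v hu hv huv
    by_contra huX
    rcases (hG' u v).1 huv with h | h
    · exact hu (WalkJoined.trans hv (.of_adj h.symm (WalkJoined.right_mem hv) huX))
    · exact huX h.2.1
  have hAB : ∀ u ∈ A, ∀ v ∈ B, ¬ G'.Adj u v :=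
    fun u hu v hv huv ↦ hv.1 (hAstep v u hv.2 hu huv.symm)
  have hBstep : ∀ u v, u ∉ B → v ∈ B → G'.Adj u v → u ∈ X := by
    intro u v hu hv huv
    by_contra huX
    have huA : u ∈ A := by
      by_contra huA
      exact hu ⟨huX, huA⟩
    exact hAB u huA v hv huv
  have hclique : ∀ x ∈ X, ∀ y ∈ X, x ≠ y → G'.Adj x y :=
    fun x hx y hy hxy ↦ (hG' x y).2 (.inr ⟨hxy, hx, hy⟩)
  have hA : ConnOn G A := connOn_setOf_walkJoined a
  have hY : ConnOn G Y := connOn_setOf_walkJoined b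
  have hXA := hatt a haX
  have hXY := hatt b hbX
  constructor
  · intro hsub
    obtain ⟨M, hM⟩ := hsub.exists_isModel
    by_cases hMB : ∀ w, ∃ u ∈ M w, u ∉ B
    · subst hXdef
      exact hM.not_isPlanar_of_completeGraph_of_side hG' hBstep hBX hMB hYB hY hXY hP
    by_cases hMA : ∀ w, ∃ u ∈ M w, u ∉ A
    · subst hXdef
      exact hM.not_isPlanar_of_completeGraph_of_side hG' hAstep hAX hMA le_rfl hA hXA hP
    push Not at hMB hMA
    obtain ⟨w', hw'⟩ := hMB
    obtain ⟨w, hw⟩ := hMA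
    by_cases hww : w = w'
    · subst hww
      obtain ⟨v, hv⟩ := exists_ne w
      obtain ⟨x, hx, -⟩ := hM.adj w v hv.symm
      exact (hw' x hx).2 (hw x hx)
    · obtain ⟨x, hx, y, hy, hxy⟩ := hM.adj w w' hww
      exact hAB x (hw x hx) y (hw' y hy) hxy
  · intro hsub
    obtain ⟨M, hM⟩ := hsub.exists_isModel
    by_cases hMB : ∀ w, ∃ u ∈ M w, u ∉ B
    · subst hXdef
      exact hM.not_isPlanar_of_completeBipartiteGraph_of_side hG' hBstep hBX hMB hYB hY hXY hP
    by_cases hMA : ∀ w, ∃ u ∈ M w, u ∉ A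
    · subst hXdef
      exact hM.not_isPlanar_of_completeBipartiteGraph_of_side hG' hAstep hAX hMA le_rfl hA hXA hP
    push Not at hMB hMA
    obtain ⟨w', hw'⟩ := hMB
    obtain ⟨w, hw⟩ := hMA
    refine hP.2 (IsModel.containsSubdivision_completeBipartiteGraph
      (hM.completeBipartiteGraph_of_separated (fun u v h ↦ ((hG' u v).1 h).imp_right And.right) hX
        hAB ?_ hw hw'))
    rintro v ⟨p, hp, c, hc, hpc⟩ ⟨q, hq, d, hd, hqd⟩
    by_contra! hvX
    have hpA : p ∈ A := by
      by_contra hpA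
      exact hvX p (hAstep p c hpA hc hpc) hp
    have hqB : q ∈ B := by
      by_contra hqB
      exact hvX q (hBstep q d hqB hd hqd) hq
    obtain ⟨x, hx, hxv, -⟩ := ((hM.conn v q hq p hp).restrict hBstep hclique hBX
      fun h ↦ h.2 hpA).2 hqB
    exact hvX x hx hxv

end AddClique

theorem stmt_15 {V : Type*} [Fintype V] (G : SimpleGraph V)
    (hP : IsPlanar G) (h3 : ThreeConnected G)
    (hG : ¬ ContainsInduced (pathGraph 5) G)
    (x₁ x₂ x₃ : V)
    (hcut : ¬ (G.induce ({x₁, x₂, x₃} : Set V)ᶜ).Connected) :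
    IsPlanar (G ⊔ fromEdgeSet {s(x₁, x₂), s(x₁, x₃), s(x₂, x₃)}) ∧
    ¬ ContainsInduced (pathGraph 5)
      (G ⊔ fromEdgeSet {s(x₁, x₂), s(x₁, x₃), s(x₂, x₃)}) := by
  have hG' : ∀ u v, (G ⊔ fromEdgeSet {s(x₁, x₂), s(x₁, x₃), s(x₂, x₃)}).Adj u v ↔
      G.Adj u v ∨ u ≠ v ∧ u ∈ ({x₁, x₂, x₃} : Set V) ∧ v ∈ ({x₁, x₂, x₃} : Set V) := by
    intro u v
    simp only [sup_adj, fromEdgeSet_adj, Set.mem_insert_iff, Set.mem_singleton_iff, Sym2.eq_iff]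
    grind
  have hX : ({x₁, x₂, x₃} : Set V).ncard ≤ 3 :=
    (Set.ncard_insert_le _ _).trans
      (Nat.succ_le_succ ((Set.ncard_insert_le _ _).trans (by simp)))
  exact ⟨isPlanar_of_clique h3 hP hcut hG',
    not_containsInduced_pathGraph_five_of_clique h3 hG hX hcut hG'⟩
end
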